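/- arXiv:2212.05049 — 5 statements merged into one kernel-verified Lean document; each statement's English description precedes it below -/
import Mathlib

section
/- Let A ⊂ ℂⁿ be a compact set not contained in any complex affine hyperplane. Then there is a unique complex ellipsoid of minimal volume containing A, where a complex ellipsoid is an image of the closed unit ball of ℂⁿ under an invertible complex affine map. -/
open MeasureTheory

/-- A complex ellipsoid in `ℂⁿ`: image of the closed unit ball under an
invertible complex affine map. -/
def IsComplexEllipsoid (n : ℕ) (E : Set (EuclideanSpace ℂ (Fin n))) : Prop :=
  ∃ (T : EuclideanSpace ℂ (Fin n) ≃ₗ[ℂ] EuclideanSpace ℂ (Fin n))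
    (v : EuclideanSpace ℂ (Fin n)),
    E = (fun x => T x + v) '' Metric.closedBall 0 1

/-- Lebesgue volume of a subset of `ℂⁿ ≅ ℝ^{2n}`. -/
noncomputable def cVolume (n : ℕ) (S : Set (EuclideanSpace ℂ (Fin n))) : ENNReal :=
  volume ((WithLp.equiv 2 (Fin n → ℂ)) '' S)

/-- The sublevel set `{x | ‖S x + w‖ ≤ 1}` contains `A`. -/
def Circumscribes {E : Type*} [NormedAddCommGroup E] [Module ℂ E]
    (A : Set E) (S : E →ₗ[ℂ] E) (w : E) : Prop :=
  ∀ x ∈ A, ‖S x + w‖ ≤ 1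

section

variable {E : Type*} [NormedAddCommGroup E] [InnerProductSpace ℂ E]

theorem Circumscribes.isometry_comp {A : Set E} {S : E →ₗ[ℂ] E} {w : E}
    (h : Circumscribes A S w) (U : E ≃ₗᵢ[ℂ] E) :
    Circumscribes A (U.toLinearEquiv.toLinearMap ∘ₗ S) (U w) := fun x hx => by
  have : ‖U (S x + w)‖ ≤ 1 := by rw [U.norm_map]; exact h x hx
  simpa using this

theorem Circumscribes.midpoint {A : Set E} {S T : E →ₗ[ℂ] E} {v w : E}
    (hS : Circumscribes A S v) (hT : Circumscribes A T w) :
    Circumscribes A ((2⁻¹ : ℂ) • (S + T)) ((2⁻¹ : ℂ) • (v + w)) := fun x hx => by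
  have : ((2⁻¹ : ℂ) • (S + T)) x + (2⁻¹ : ℂ) • (v + w) = (2⁻¹ : ℂ) • ((S x + v) + (T x + w)) := by
    simp only [LinearMap.smul_apply, LinearMap.add_apply, smul_add]; abel
  rw [this, norm_smul, norm_inv, Complex.norm_ofNat]
  linarith [norm_add_le (S x + v) (T x + w), hS x hx, hT x hx]

variable [FiniteDimensional ℂ E]

theorem isCompact_setOf_circumscribes {A : Set E} (hflat : affineSpan ℂ A = ⊤) :
    IsCompact {p : (E →L[ℂ] E) × E | Circumscribes A (p.1 : E →ₗ[ℂ] E) p.2} := by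
  let Φ : (E →L[ℂ] E) × E →ₗ[ℂ] (A → E) :=
    { toFun := fun p x => p.1 x + p.2
      map_add' := fun p q => by ext x; simp; abel
      map_smul' := fun c p => by ext x; simp }
  have hker : LinearMap.ker Φ = ⊥ := by
    rw [LinearMap.ker_eq_bot']
    rintro ⟨S, w⟩ h
    have hzero : ∀ x ∈ A, S x + w = 0 := fun x hx => congrFun h ⟨x, hx⟩
    have hle : affineSpan ℂ A ≤
        (AffineSubspace.mk' (0 : E) (⊥ : Submodule ℂ E)).comap
          ((S : E →ₗ[ℂ] E).toAffineMap + AffineMap.const ℂ E w) := by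
      rw [affineSpan_le]
      intro x hx
      simpa [AffineSubspace.mem_mk'] using hzero x hx
    rw [hflat] at hle
    have hall : ∀ x, S x + w = 0 := fun x => by
      simpa [AffineSubspace.mem_mk'] using hle (AffineSubspace.mem_top ℂ E x)
    have hw : w = 0 := by simpa using hall 0
    subst hw
    have hS : S = 0 := by ext x; simpa using hall x
    simp [hS]
  have hK : {p : (E →L[ℂ] E) × E | Circumscribes A (p.1 : E →ₗ[ℂ] E) p.2} =
      Φ ⁻¹' Set.univ.pi fun _ => Metric.closedBall 0 1 := by
    ext p
    simp [Circumscribes, Φ]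
  have : ProperSpace E := FiniteDimensional.proper ℂ E
  rw [hK]
  exact (LinearMap.isClosedEmbedding_of_injective hker).isCompact_preimage
    (isCompact_univ_pi fun _ => isCompact_closedBall 0 1)

theorem exists_circumscribes_maximal_det {A : Set E} (hA : IsCompact A)
    (hflat : affineSpan ℂ A = ⊤) :
    ∃ (S : E →ₗ[ℂ] E) (w : E), Circumscribes A S w ∧ LinearMap.det S ≠ 0 ∧
      ∀ S' w', Circumscribes A S' w' → ‖LinearMap.det S'‖ ≤ ‖LinearMap.det S‖ := by
  obtain ⟨r, hr, hAr⟩ := hA.isBounded.exists_pos_norm_le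
  have h₀ : Circumscribes A (((r⁻¹ : ℝ) : ℂ) • (LinearMap.id : E →ₗ[ℂ] E)) 0 := by
    intro x hx
    simp only [LinearMap.smul_apply, LinearMap.id_apply, add_zero, norm_smul, Complex.norm_real,
      norm_inv, Real.norm_of_nonneg hr.le]
    rw [inv_mul_le_iff₀ hr, mul_one]
    exact hAr x hx
  have hdet₀ : LinearMap.det (((r⁻¹ : ℝ) : ℂ) • (LinearMap.id : E →ₗ[ℂ] E)) ≠ 0 := by
    simp [LinearMap.det_smul, hr.ne']
  obtain ⟨p, hp, hmax⟩ := (isCompact_setOf_circumscribes hflat).exists_isMaxOn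
    ⟨(LinearMap.toContinuousLinearMap (((r⁻¹ : ℝ) : ℂ) • (LinearMap.id : E →ₗ[ℂ] E)), 0),
      by simpa using h₀⟩
    ((ContinuousLinearMap.continuous_det.comp continuous_fst).norm.continuousOn)
  have hle : ∀ S' w', Circumscribes A S' w' →
      ‖LinearMap.det S'‖ ≤ ‖LinearMap.det (p.1 : E →ₗ[ℂ] E)‖ := by
    intro S' w' h
    simpa [ContinuousLinearMap.det] using
      hmax (a := (LinearMap.toContinuousLinearMap S', w')) (by simpa using h)
  refine ⟨p.1, p.2, hp, fun h => ?_, hle⟩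
  have := hle _ _ h₀
  rw [h, norm_zero, norm_le_zero_iff] at this
  exact hdet₀ this

theorem LinearMap.exists_isometry_comp_diagonal (N : E →ₗ[ℂ] E) (hN : Function.Injective N) :
    ∃ (U : E ≃ₗᵢ[ℂ] E) (b : OrthonormalBasis (Fin (Module.finrank ℂ E)) ℂ E)
      (σ : Fin (Module.finrank ℂ E) → ℝ), (∀ i, 0 < σ i) ∧
        ∀ i, U (N (b i)) = (σ i : ℂ) • b i := by
  have hsymm : (LinearMap.adjoint N ∘ₗ N).IsSymmetric :=
    (LinearMap.isPositive_adjoint_comp_self N).isSymmetric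
  set b := hsymm.eigenvectorBasis rfl with hb
  have hinner : ∀ i j, i ≠ j → inner ℂ (N (b i)) (N (b j)) = 0 := by
    intro i j hij
    have h := hsymm.apply_eigenvectorBasis rfl j
    rw [← LinearMap.adjoint_inner_right, ← LinearMap.comp_apply, h, inner_smul_right,
      ← hb, b.inner_eq_zero hij, mul_zero]
  have hpos : ∀ i, 0 < ‖N (b i)‖ := fun i => by
    rw [norm_pos_iff, Ne, map_eq_zero_iff N hN]
    exact b.orthonormal.ne_zero i
  have hc : Orthonormal ℂ fun i => ((‖N (b i)‖⁻¹ : ℝ) : ℂ) • N (b i) := by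
    refine ⟨fun i => ?_, fun i j hij => ?_⟩
    · rw [norm_smul, Complex.norm_real, norm_inv, norm_norm, inv_mul_cancel₀ (hpos i).ne']
    · simp only [inner_smul_left, inner_smul_right, hinner i j hij, mul_zero]
  let c : OrthonormalBasis (Fin (Module.finrank ℂ E)) ℂ E := OrthonormalBasis.mk hc
    (hc.linearIndependent.span_eq_top_of_card_eq_finrank' (Fintype.card_fin _)).ge
  refine ⟨c.equiv b (Equiv.refl _), b, fun i => ‖N (b i)‖, hpos, fun i => ?_⟩
  have hci : N (b i) = ((‖N (b i)‖ : ℝ) : ℂ) • c i := by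
    rw [OrthonormalBasis.coe_mk, smul_smul, ← Complex.ofReal_mul, mul_inv_cancel₀ (hpos i).ne',
      Complex.ofReal_one, one_smul]
  conv_lhs => rw [hci]
  rw [map_smul, OrthonormalBasis.equiv_apply_basis, Equiv.refl_apply]

theorem LinearMap.det_eq_prod_of_apply_basis {ι R M : Type*} [Fintype ι] [DecidableEq ι]
    [CommRing R] [AddCommGroup M] [Module R M] (b : Module.Basis ι R M) (f : M →ₗ[R] M) (d : ι → R)
    (h : ∀ i, f (b i) = d i • b i) : LinearMap.det f = ∏ i, d i := by
  rw [← LinearMap.det_toMatrix b, ← Matrix.det_diagonal]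
  congr 1
  ext i j
  rw [LinearMap.toMatrix_apply, h, map_smul, Matrix.diagonal_apply]
  by_cases hij : i = j <;> simp [hij]

theorem eq_one_of_prod_midpoint_le {ι : Type*} [Fintype ι] (σ : ι → ℝ) (hσ : ∀ i, 0 < σ i)
    (hprod : ∏ i, σ i = 1) (hmid : ∏ i, ((1 + σ i) / 2) ≤ 1) (i : ι) : σ i = 1 := by
  by_contra hne
  have hlt : ∏ i, σ i < ∏ i, ((1 + σ i) / 2) ^ 2 := by
    refine Finset.prod_lt_prod (fun j _ => hσ j)
      (fun j _ => by nlinarith [sq_nonneg (1 - σ j)]) ⟨i, Finset.mem_univ i, ?_⟩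
    have : 0 < (1 - σ i) ^ 2 := by
      have : 1 - σ i ≠ 0 := fun h => hne (by linarith)
      positivity
    nlinarith
  rw [hprod, Finset.prod_pow] at hlt
  have hnn : 0 ≤ ∏ i, ((1 + σ i) / 2) :=
    Finset.prod_nonneg fun j _ => by linarith [hσ j]
  nlinarith

theorem Circumscribes.eq_of_maximal_det {A : Set E} {S : E →ₗ[ℂ] E} {v w : E}
    (hv : Circumscribes A S v) (hw : Circumscribes A S w) (hS : LinearMap.det S ≠ 0)
    (hmax : ∀ S' w', Circumscribes A S' w' → ‖LinearMap.det S'‖ ≤ ‖LinearMap.det S‖) :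
    v = w := by
  by_contra hne
  set δ : ℝ := ‖(2⁻¹ : ℂ) • (v - w)‖ with hδ
  have hδpos : 0 < δ := norm_pos_iff.2 (smul_ne_zero (by norm_num) (sub_ne_zero.2 hne))
  set t : ℝ := √(1 + δ ^ 2)
  have ht2 : t ^ 2 = 1 + δ ^ 2 := Real.sq_sqrt (by positivity)
  have ht1 : 1 < t := Real.lt_sqrt_of_sq_lt (by nlinarith)
  have hadm : Circumscribes A ((t : ℂ) • S) ((t : ℂ) • (2⁻¹ : ℂ) • (v + w)) := by
    intro x hx
    have hpar := parallelogram_law_with_norm ℂ ((2⁻¹ : ℂ) • (S x + v)) ((2⁻¹ : ℂ) • (S x + w))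
    have hadd : (2⁻¹ : ℂ) • (S x + v) + (2⁻¹ : ℂ) • (S x + w) = S x + (2⁻¹ : ℂ) • (v + w) := by
      module
    have hsub : (2⁻¹ : ℂ) • (S x + v) - (2⁻¹ : ℂ) • (S x + w) = (2⁻¹ : ℂ) • (v - w) := by
      module
    rw [hadd, hsub, ← hδ, norm_smul, norm_smul, norm_inv, Complex.norm_ofNat] at hpar
    rw [LinearMap.smul_apply, ← smul_add, norm_smul, Complex.norm_real,
      Real.norm_of_nonneg (by linarith)]
    have h1 := hv x hx
    have h2 := hw x hx
    have h1' : ‖S x + v‖ ^ 2 ≤ 1 := pow_le_one₀ (norm_nonneg _) h1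
    have h2' : ‖S x + w‖ ^ 2 ≤ 1 := pow_le_one₀ (norm_nonneg _) h2
    set a := ‖S x + (2⁻¹ : ℂ) • (v + w)‖
    have ha : a ^ 2 ≤ 1 - δ ^ 2 := by nlinarith
    have : (t * a) ^ 2 ≤ 1 := by
      rw [mul_pow, ht2]
      nlinarith [mul_le_mul_of_nonneg_left ha (by positivity : 0 ≤ 1 + δ ^ 2), sq_nonneg (δ ^ 2)]
    exact (sq_le_one_iff₀ (by positivity)).1 this
  have hle := hmax _ _ hadm
  rw [LinearMap.det_smul, norm_mul, norm_pow, Complex.norm_real,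
    Real.norm_of_nonneg (by linarith)] at hle
  have : Nontrivial E := ⟨v, w, hne⟩
  have hlt : 1 < t ^ Module.finrank ℂ E := one_lt_pow₀ ht1 Module.finrank_pos.ne'
  nlinarith [norm_pos_iff.2 hS]

theorem norm_det_isometry_comp (U : E ≃ₗᵢ[ℂ] E) (S : E →ₗ[ℂ] E) :
    ‖LinearMap.det (U.toLinearEquiv.toLinearMap ∘ₗ S)‖ = ‖LinearMap.det S‖ := by
  have hU : ‖LinearMap.det U.toLinearEquiv.toLinearMap‖ = 1 := by
    rw [← LinearMap.normDet_eq_norm_det]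
    exact U.toLinearIsometry.normDet_eq_one
  rw [LinearMap.det_comp, norm_mul, hU, one_mul]

theorem Circumscribes.norm_eq_of_maximal_det {A : Set E} {S T : E →ₗ[ℂ] E} {v w : E}
    (hS : Circumscribes A S v) (hT : Circumscribes A T w) (hdet : LinearMap.det S ≠ 0)
    (heq : ‖LinearMap.det T‖ = ‖LinearMap.det S‖)
    (hmax : ∀ S' w', Circumscribes A S' w' → ‖LinearMap.det S'‖ ≤ ‖LinearMap.det S‖) (x : E) :
    ‖S x + v‖ = ‖T x + w‖ := by
  let e := LinearMap.equivOfDetNeZero S hdet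
  have hTdet : LinearMap.det T ≠ 0 := by
    rwa [← norm_ne_zero_iff, heq, norm_ne_zero_iff]
  let N : E →ₗ[ℂ] E := T ∘ₗ e.symm.toLinearMap
  have hNS : N ∘ₗ S = T := by
    ext x
    change T (e.symm (e x)) = T x
    rw [e.symm_apply_apply]
  have hN : Function.Injective N :=
    (LinearMap.equivOfDetNeZero T hTdet).injective.comp e.symm.injective
  obtain ⟨U, b, σ, hσ, hU⟩ := N.exists_isometry_comp_diagonal hN
  let P : E →ₗ[ℂ] E := U.toLinearEquiv.toLinearMap ∘ₗ N
  have hPS : U.toLinearEquiv.toLinearMap ∘ₗ T = P ∘ₗ S := by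
    rw [← hNS, ← LinearMap.comp_assoc]
  have hPdet : LinearMap.det P = ∏ i, (σ i : ℂ) :=
    LinearMap.det_eq_prod_of_apply_basis b.toBasis P _ fun i => by simpa [P] using hU i
  have hpos : 0 < ‖LinearMap.det S‖ := norm_pos_iff.2 hdet
  have hprod : ∏ i, σ i = 1 := by
    have h := norm_det_isometry_comp U T
    rw [hPS, LinearMap.det_comp, norm_mul, heq, hPdet, ← Complex.ofReal_prod, Complex.norm_real,
      Real.norm_of_nonneg (Finset.prod_nonneg fun i _ => (hσ i).le)] at h
    exact (mul_eq_right₀ hpos.ne').1 h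
  have hUT := hT.isometry_comp U
  have hmid : ∏ i, ((1 + σ i) / 2) ≤ 1 := by
    have h := hmax _ _ (hS.midpoint hUT)
    have hfac : (2⁻¹ : ℂ) • (S + U.toLinearEquiv.toLinearMap ∘ₗ T) =
        ((2⁻¹ : ℂ) • (LinearMap.id + P)) ∘ₗ S := by
      rw [hPS, LinearMap.smul_comp, LinearMap.add_comp, LinearMap.id_comp]
    have hdetm : LinearMap.det ((2⁻¹ : ℂ) • (LinearMap.id + P)) =
        ∏ i, (((1 + σ i) / 2 : ℝ) : ℂ) := by
      refine LinearMap.det_eq_prod_of_apply_basis b.toBasis _ _ fun i => ?_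
      have hPi : P (b i) = (σ i : ℂ) • b i := hU i
      rw [OrthonormalBasis.coe_toBasis, LinearMap.smul_apply, LinearMap.add_apply,
        LinearMap.id_apply, hPi]
      push_cast
      module
    rw [hfac, LinearMap.det_comp, norm_mul, hdetm, ← Complex.ofReal_prod, Complex.norm_real] at h
    exact (le_abs_self _).trans ((mul_le_iff_le_one_left hpos).1 h)
  have hPid : P = LinearMap.id := b.toBasis.ext fun i => by
    have hPi : P (b i) = (σ i : ℂ) • b i := hU i
    rw [OrthonormalBasis.coe_toBasis, hPi, eq_one_of_prod_midpoint_le σ hσ hprod hmid i]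
    simp
  rw [hPid, LinearMap.id_comp] at hPS
  rw [hPS] at hUT
  rw [hS.eq_of_maximal_det hUT hdet hmax, ← hPS, ← U.norm_map (T x + w), map_add]
  rfl

end

theorem IsComplexEllipsoid.exists_eq_setOf {n : ℕ} {E : Set (EuclideanSpace ℂ (Fin n))}
    (hE : IsComplexEllipsoid n E) :
    ∃ (S : EuclideanSpace ℂ (Fin n) →ₗ[ℂ] EuclideanSpace ℂ (Fin n))
      (w : EuclideanSpace ℂ (Fin n)), LinearMap.det S ≠ 0 ∧ E = {x | ‖S x + w‖ ≤ 1} := by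
  obtain ⟨T, v, rfl⟩ := hE
  refine ⟨T.symm.toLinearMap, -T.symm v, T.symm.isUnit_det'.ne_zero, ?_⟩
  ext x
  simp only [Set.mem_image, mem_closedBall_zero_iff, Set.mem_ofPred_eq]
  constructor
  · rintro ⟨y, hy, rfl⟩
    simpa using hy
  · intro h
    exact ⟨T.symm x + -T.symm v, h, by simp⟩

theorem setOf_norm_le_one_eq_image {n : ℕ}
    {S : EuclideanSpace ℂ (Fin n) →ₗ[ℂ] EuclideanSpace ℂ (Fin n)}
    (hS : LinearMap.det S ≠ 0) (w : EuclideanSpace ℂ (Fin n)) :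
    {x | ‖S x + w‖ ≤ 1} = (fun x => (LinearMap.equivOfDetNeZero S hS).symm x +
      -(LinearMap.equivOfDetNeZero S hS).symm w) '' Metric.closedBall 0 1 := by
  set e := LinearMap.equivOfDetNeZero S hS
  have he : ∀ x, S x = e x := fun _ => rfl
  ext x
  simp only [Set.mem_image, mem_closedBall_zero_iff, Set.mem_ofPred_eq]
  constructor
  · intro h
    exact ⟨S x + w, h, by simp [he]⟩
  · rintro ⟨y, hy, rfl⟩
    simpa [he] using hy

theorem cVolume_image (n : ℕ) (T : EuclideanSpace ℂ (Fin n) ≃ₗ[ℂ] EuclideanSpace ℂ (Fin n))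
    (v : EuclideanSpace ℂ (Fin n)) (B : Set (EuclideanSpace ℂ (Fin n))) :
    cVolume n ((fun x => T x + v) '' B) =
      ENNReal.ofReal (‖LinearMap.det T.toLinearMap‖ ^ 2) * cVolume n B := by
  let e := WithLp.linearEquiv 2 ℂ (Fin n → ℂ)
  let T' : (Fin n → ℂ) →ₗ[ℂ] (Fin n → ℂ) := e.toLinearMap ∘ₗ T.toLinearMap ∘ₗ e.symm.toLinearMap
  have himage : WithLp.equiv 2 (Fin n → ℂ) '' ((fun x => T x + v) '' B) =
      (fun y => y + e v) '' (T'.restrictScalars ℝ '' (WithLp.equiv 2 (Fin n → ℂ) '' B)) := by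
    simp only [Set.image_image]
    rfl
  have hdet : LinearMap.det (T'.restrictScalars ℝ) = ‖LinearMap.det T.toLinearMap‖ ^ 2 := by
    rw [LinearMap.det_restrictScalars, LinearMap.det_conj, Algebra.norm_complex_apply,
      Complex.normSq_eq_norm_sq]
  rw [cVolume, himage, Set.image_add_right, measure_preimage_add_right,
    Measure.addHaar_image_linearMap, hdet, abs_of_nonneg (by positivity), cVolume]

theorem cVolume_closedBall_ne_zero (n : ℕ) : cVolume n (Metric.closedBall 0 1) ≠ 0 := by
  have hopen : IsOpen (EuclideanSpace.equiv (Fin n) ℂ '' Metric.ball 0 1) :=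
    (EuclideanSpace.equiv (Fin n) ℂ).toHomeomorph.isOpenMap _ Metric.isOpen_ball
  have hpos := hopen.measure_pos volume ((Metric.nonempty_ball.2 one_pos).image _)
  exact (hpos.trans_le (measure_mono (Set.image_mono Metric.ball_subset_closedBall))).ne'

theorem cVolume_closedBall_ne_top (n : ℕ) : cVolume n (Metric.closedBall 0 1) ≠ ⊤ :=
  ((isCompact_closedBall (0 : EuclideanSpace ℂ (Fin n)) 1).image
    (EuclideanSpace.equiv (Fin n) ℂ).continuous).measure_lt_top.ne

theorem cVolume_setOf_le_iff {n : ℕ}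
    {S T : EuclideanSpace ℂ (Fin n) →ₗ[ℂ] EuclideanSpace ℂ (Fin n)}
    (hS : LinearMap.det S ≠ 0) (hT : LinearMap.det T ≠ 0) (v w : EuclideanSpace ℂ (Fin n)) :
    cVolume n {x | ‖S x + v‖ ≤ 1} ≤ cVolume n {x | ‖T x + w‖ ≤ 1} ↔
      ‖LinearMap.det T‖ ≤ ‖LinearMap.det S‖ := by
  have hinv : ∀ {R : EuclideanSpace ℂ (Fin n) →ₗ[ℂ] EuclideanSpace ℂ (Fin n)}
      (hR : LinearMap.det R ≠ 0),
      LinearMap.det (LinearMap.equivOfDetNeZero R hR).symm.toLinearMap = (LinearMap.det R)⁻¹ :=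
    fun {R} hR => eq_inv_of_mul_eq_one_left (LinearMap.equivOfDetNeZero R hR).det_symm_mul_det
  rw [setOf_norm_le_one_eq_image hS, setOf_norm_le_one_eq_image hT, cVolume_image, cVolume_image,
    ENNReal.mul_le_mul_iff_left (cVolume_closedBall_ne_zero n) (cVolume_closedBall_ne_top n),
    ENNReal.ofReal_le_ofReal_iff (by positivity), hinv, hinv, norm_inv, norm_inv,
    pow_le_pow_iff_left₀ (by positivity) (by positivity) two_ne_zero,
    inv_le_inv₀ (norm_pos_iff.2 hS) (norm_pos_iff.2 hT)]

/-- A compact set `A ⊂ ℂⁿ` not contained in any complex affine hyperplane has a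
unique circumscribed complex ellipsoid of minimal volume. -/
theorem exists_unique_minimal_circumscribed_ellipsoid (n : ℕ)
    (A : Set (EuclideanSpace ℂ (Fin n))) (hA : IsCompact A)
    (hflat : affineSpan ℂ A = ⊤) :
    ∃! E : Set (EuclideanSpace ℂ (Fin n)),
      IsComplexEllipsoid n E ∧ A ⊆ E ∧
        ∀ E' : Set (EuclideanSpace ℂ (Fin n)),
          IsComplexEllipsoid n E' → A ⊆ E' → cVolume n E ≤ cVolume n E' := by
  obtain ⟨S, v, hS, hdet, hmax⟩ := exists_circumscribes_maximal_det hA hflat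
  have hell : IsComplexEllipsoid n {x | ‖S x + v‖ ≤ 1} :=
    ⟨_, _, setOf_norm_le_one_eq_image hdet v⟩
  refine ⟨{x | ‖S x + v‖ ≤ 1}, ⟨hell, hS, fun E' hE' hAE' => ?_⟩, ?_⟩
  · obtain ⟨T, w, hT, rfl⟩ := hE'.exists_eq_setOf
    exact (cVolume_setOf_le_iff hdet hT v w).2 (hmax T w hAE')
  · rintro E' ⟨hE', hAE', hmin⟩
    obtain ⟨T, w, hT, rfl⟩ := hE'.exists_eq_setOf
    have hle := (cVolume_setOf_le_iff hT hdet w v).1 (hmin _ hell hS)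
    ext x
    rw [Set.mem_ofPred_eq, Set.mem_ofPred_eq,
      hS.norm_eq_of_maximal_det hAE' hdet ((hmax T w hAE').antisymm hle) hmax x]
end

section
/- Let A ⊂ ℂⁿ be a compact set not contained in any complex affine hyperplane, and let E₁, E₂ be two complex ellipsoids of maximal volume contained in the convex hull of A. Then E₂ is a translate of E₁, i.e., there is c ∈ ℂⁿ with E₂ = E₁ + c. -/
open MeasureTheory

/-- Singular value decomposition of an invertible operator. -/
theorem LinearEquiv.exists_orthonormalBasis_smul_apply_eq {n : ℕ}
    (S : EuclideanSpace ℂ (Fin n) ≃ₗ[ℂ] EuclideanSpace ℂ (Fin n)) :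
    ∃ (b w : OrthonormalBasis (Fin n) ℂ (EuclideanSpace ℂ (Fin n))) (σ : Fin n → ℝ),
      (∀ i, 0 < σ i) ∧ ∀ i, (σ i : ℂ) • S (b i) = w i := by
  have hsym : (S.toLinearMap.adjoint ∘ₗ S.toLinearMap).IsSymmetric := by
    intro x y
    simp [LinearMap.adjoint_inner_left, LinearMap.adjoint_inner_right]
  have hcard : Module.finrank ℂ (EuclideanSpace ℂ (Fin n)) = n := by simp
  set b := hsym.eigenvectorBasis hcard with hb
  have hpos : ∀ i, 0 < ‖S (b i)‖ := fun i => norm_pos_iff.2 <| by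
    simpa using b.orthonormal.ne_zero i
  have hw : Orthonormal ℂ fun i => ((‖S (b i)‖⁻¹ : ℝ) : ℂ) • S (b i) := by
    refine ⟨fun i => ?_, fun i j hij => ?_⟩
    · have := (hpos i).ne'
      simp [norm_smul, this]
    · have h : inner ℂ (S (b i)) (S (b j)) = 0 := by
        have := LinearMap.adjoint_inner_right S.toLinearMap (b i) (S (b j))
        have h2 := hsym.apply_eigenvectorBasis hcard j
        simp only [LinearMap.comp_apply, LinearEquiv.coe_coe] at this h2
        rw [← hb] at h2
        rw [← this, h2, inner_smul_right, b.orthonormal.2 hij, mul_zero]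
      simp [inner_smul_left, inner_smul_right, h]
  refine ⟨b, OrthonormalBasis.mk hw ?_, fun i => ‖S (b i)‖⁻¹, fun i => inv_pos.2 (hpos i), by simp⟩
  rw [hw.linearIndependent.span_eq_top_of_card_eq_finrank' (by simp)]

theorem cVolume_image_closedBall {n : ℕ}
    (T : EuclideanSpace ℂ (Fin n) →ₗ[ℂ] EuclideanSpace ℂ (Fin n))
    (v : EuclideanSpace ℂ (Fin n)) :
    cVolume n ((fun x => T x + v) '' Metric.closedBall 0 1) =
      ENNReal.ofReal (‖LinearMap.det T‖ ^ 2) * cVolume n (Metric.closedBall 0 1) := by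
  let e := WithLp.linearEquiv 2 ℂ (Fin n → ℂ)
  let L := (e.toLinearMap ∘ₗ T ∘ₗ e.symm.toLinearMap)
  have himg : (WithLp.equiv 2 (Fin n → ℂ)) '' ((fun x => T x + v) '' Metric.closedBall 0 1) =
      (fun y => y + e v) '' (L.restrictScalars ℝ ''
        ((WithLp.equiv 2 (Fin n → ℂ)) '' Metric.closedBall 0 1)) := by
    simp only [Set.image_image]
    rfl
  have hdet : |LinearMap.det (L.restrictScalars ℝ)| = ‖LinearMap.det T‖ ^ 2 := by
    rw [LinearMap.det_restrictScalars, LinearMap.det_conj, Algebra.norm_complex_apply,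
      Complex.normSq_eq_norm_sq, abs_of_nonneg (by positivity)]
  unfold cVolume
  rw [himg, Set.image_add_right, measure_preimage_add_right,
    Measure.addHaar_image_linearMap, hdet]

theorem norm_det_le_of_cVolume_le {n : ℕ}
    {S T : EuclideanSpace ℂ (Fin n) →ₗ[ℂ] EuclideanSpace ℂ (Fin n)}
    {u v : EuclideanSpace ℂ (Fin n)}
    (h : cVolume n ((fun x => S x + u) '' Metric.closedBall 0 1) ≤
      cVolume n ((fun x => T x + v) '' Metric.closedBall 0 1)) :
    ‖LinearMap.det S‖ ≤ ‖LinearMap.det T‖ := by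
  rw [cVolume_image_closedBall, cVolume_image_closedBall,
    ENNReal.mul_le_mul_iff_left (cVolume_closedBall_ne_zero n) (cVolume_closedBall_ne_top n),
    ENNReal.ofReal_le_ofReal_iff (by positivity)] at h
  exact (sq_le_sq₀ (norm_nonneg _) (norm_nonneg _)).1 h

theorem eq_one_of_prod_eq_one_of_prod_midpoint_le_one {ι : Type*} [Fintype ι] {σ : ι → ℝ}
    (hpos : ∀ i, 0 < σ i) (hprod : ∏ i, σ i = 1) (hmid : ∏ i, (1 + σ i) / 2 ≤ 1) (i : ι) :
    σ i = 1 := by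
  by_contra hne
  have hlt : ∏ i, σ i < ∏ i, ((1 + σ i) / 2) ^ 2 := by
    refine Finset.prod_lt_prod (fun j _ => hpos j) (fun j _ => ?_) ⟨i, Finset.mem_univ i, ?_⟩
    · nlinarith [sq_nonneg (σ j - 1)]
    · nlinarith [sq_pos_of_ne_zero (sub_ne_zero.2 hne)]
  rw [hprod, Finset.prod_pow] at hlt
  have h0 : 0 ≤ ∏ i, (1 + σ i) / 2 :=
    Finset.prod_nonneg fun j _ => by linarith [hpos j]
  exact absurd (pow_le_one₀ h0 hmid) hlt.not_ge

theorem image_comp_linearIsometryEquiv_closedBall {E F : Type*} [NormedAddCommGroup E]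
    [NormedSpace ℂ E] (f : E → F) (U : E ≃ₗᵢ[ℂ] E) :
    (fun x => f (U x)) '' Metric.closedBall 0 1 = f '' Metric.closedBall 0 1 := by
  rw [← Set.image_image f U, U.image_closedBall, map_zero]

/-- Two maximal-volume complex ellipsoids inscribed in the convex hull of a
non-flat compact set are translates of each other. -/
theorem maximal_inscribed_ellipsoids_translate (n : ℕ)
    (A : Set (EuclideanSpace ℂ (Fin n))) (hA : IsCompact A)
    (hflat : affineSpan ℂ A = ⊤)
    (E₁ E₂ : Set (EuclideanSpace ℂ (Fin n)))
    (hE₁ : IsComplexEllipsoid n E₁) (hE₂ : IsComplexEllipsoid n E₂)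
    (hsub₁ : E₁ ⊆ convexHull ℝ A) (hsub₂ : E₂ ⊆ convexHull ℝ A)
    (hmax₁ : ∀ E', IsComplexEllipsoid n E' → E' ⊆ convexHull ℝ A →
        cVolume n E' ≤ cVolume n E₁)
    (hmax₂ : ∀ E', IsComplexEllipsoid n E' → E' ⊆ convexHull ℝ A →
        cVolume n E' ≤ cVolume n E₂) :
    ∃ c : EuclideanSpace ℂ (Fin n), E₂ = (fun x => x + c) '' E₁ := by
  obtain ⟨T₁, v₁, rfl⟩ := hE₁
  obtain ⟨T₂, v₂, rfl⟩ := hE₂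
  obtain ⟨b, w, σ, hpos, hbw⟩ := (T₁.trans T₂.symm).exists_orthonormalBasis_smul_apply_eq
  set R₁ := b.repr.symm.toLinearEquiv.trans T₁ with hR₁
  set R₂ := w.repr.symm.toLinearEquiv.trans T₂ with hR₂
  have him₁ : (fun x => T₁ x + v₁) '' Metric.closedBall 0 1 =
      (fun x => R₁.toLinearMap x + v₁) '' Metric.closedBall 0 1 :=
    (image_comp_linearIsometryEquiv_closedBall (fun x => T₁ x + v₁) b.repr.symm).symm
  have him₂ : (fun x => T₂ x + v₂) '' Metric.closedBall 0 1 =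
      (fun x => R₂.toLinearMap x + v₂) '' Metric.closedBall 0 1 :=
    (image_comp_linearIsometryEquiv_closedBall (fun x => T₂ x + v₂) w.repr.symm).symm
  rw [him₁] at hsub₁ hmax₁ ⊢
  rw [him₂] at hsub₂ hmax₂ ⊢
  let e := (EuclideanSpace.basisFun (Fin n) ℂ).toBasis
  let D : (Fin n → ℝ) → (EuclideanSpace ℂ (Fin n) →ₗ[ℂ] EuclideanSpace ℂ (Fin n)) :=
    fun d => Matrix.toLin e e (Matrix.diagonal fun i => (d i : ℂ))
  have hDe (d : Fin n → ℝ) (i : Fin n) : D d (e i) = (d i : ℂ) • e i := by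
    simp [D, Matrix.toLin_self, Matrix.diagonal_apply]
  have hDdet (d : Fin n → ℝ) (hd : ∀ i, 0 < d i) : ‖LinearMap.det (D d)‖ = ∏ i, d i := by
    simp [D, LinearMap.det_toLin, Matrix.det_diagonal, abs_of_pos (hd _)]
  have hR : R₂.toLinearMap = R₁.toLinearMap ∘ₗ D σ := by
    refine e.ext fun i => ?_
    rw [LinearMap.comp_apply, hDe, map_smul]
    have h := congrArg T₂ (hbw i)
    rw [map_smul, LinearEquiv.trans_apply, T₂.apply_symm_apply] at h
    simpa [hR₁, hR₂, e] using h.symm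
  have hmid_pos (i : Fin n) : 0 < (1 + σ i) / 2 := by linarith [hpos i]
  set M := R₁.toLinearMap ∘ₗ D fun i => (1 + σ i) / 2 with hM
  have hMeq (x) : M x = (2⁻¹ : ℝ) • R₁ x + (2⁻¹ : ℝ) • R₂ x := by
    have : M = (2⁻¹ : ℂ) • R₁.toLinearMap + (2⁻¹ : ℂ) • R₂.toLinearMap := by
      rw [hR]
      refine e.ext fun i => ?_
      simp only [hM, LinearMap.add_apply, LinearMap.smul_apply, LinearMap.comp_apply, hDe,
        map_smul, smul_smul, ← add_smul]
      congr 1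
      push_cast
      ring
    rw [this]
    simp [← Complex.coe_smul]
  have hdet₁ : 0 < ‖LinearMap.det R₁.toLinearMap‖ :=
    norm_pos_iff.2 (LinearEquiv.isUnit_det' R₁).ne_zero
  have hdetM : ‖LinearMap.det M‖ =
      ‖LinearMap.det R₁.toLinearMap‖ * ∏ i, (1 + σ i) / 2 := by
    rw [hM, LinearMap.det_comp, norm_mul, hDdet _ hmid_pos]
  have hdet₂ : ‖LinearMap.det R₂.toLinearMap‖ =
      ‖LinearMap.det R₁.toLinearMap‖ * ∏ i, σ i := by
    rw [hR, LinearMap.det_comp, norm_mul, hDdet _ hpos]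
  have hMunit : LinearMap.det M ≠ 0 := by
    rw [← norm_pos_iff, hdetM]
    exact mul_pos hdet₁ (Finset.prod_pos fun i _ => hmid_pos i)
  have hvol_mid := hmax₁ ((fun x => M x + ((2⁻¹ : ℝ) • v₁ + (2⁻¹ : ℝ) • v₂)) ''
      Metric.closedBall 0 1) ⟨LinearMap.equivOfDetNeZero M hMunit, _, rfl⟩ <| by
    rintro _ ⟨x, hx, rfl⟩
    have h := convex_convexHull ℝ A (hsub₁ ⟨x, hx, rfl⟩) (hsub₂ ⟨x, hx, rfl⟩)
      (by norm_num : (0 : ℝ) ≤ 2⁻¹) (by norm_num : (0 : ℝ) ≤ 2⁻¹) (by norm_num)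
    convert h using 1
    simp only [hMeq, LinearEquiv.coe_coe, smul_add]
    abel
  have hprod : ∏ i, σ i = 1 := by
    have h := (norm_det_le_of_cVolume_le (hmax₁ _ ⟨R₂, v₂, rfl⟩ hsub₂)).antisymm
      (norm_det_le_of_cVolume_le (hmax₂ _ ⟨R₁, v₁, rfl⟩ hsub₁))
    rwa [hdet₂, mul_eq_left₀ hdet₁.ne'] at h
  have hmid : ∏ i, (1 + σ i) / 2 ≤ 1 := by
    have h := norm_det_le_of_cVolume_le hvol_mid
    rwa [hdetM, mul_le_iff_le_one_right hdet₁] at h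
  have hR' : R₂.toLinearMap = R₁.toLinearMap := by
    rw [hR]
    refine e.ext fun i => ?_
    rw [LinearMap.comp_apply, hDe, eq_one_of_prod_eq_one_of_prod_midpoint_le_one hpos hprod hmid i]
    simp
  refine ⟨v₂ - v₁, ?_⟩
  rw [Set.image_image, hR']
  simp
end

section
/- Let K ⊂ ℂⁿ (n ≥ 2) be a real ellipsoid (image of the unit ball of ℝ^{2n} under an invertible real affine map, where ℂⁿ is identified with ℝ^{2n}) that is complex symmetric. Then K is a complex ellipsoid, i.e., the image of the unit ball of ℂⁿ under an invertible complex affine map. -/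
open Pointwise

/-- A real inner product norm on a complex vector space that is invariant under unit scalars is
the Euclidean norm in suitable complex linear coordinates. -/
theorem exists_complexLinearEquiv_norm_eq {V F : Type*} [AddCommGroup V] [Module ℂ V] [Module ℝ V]
    [IsScalarTower ℝ ℂ V] [FiniteDimensional ℂ V] [NormedAddCommGroup F] [InnerProductSpace ℝ F]
    (A : V →ₗ[ℝ] F) (hinj : Function.Injective A)
    (hA : ∀ (ξ : ℂ) (x : V), ‖ξ‖ = 1 → ‖A (ξ • x)‖ = ‖A x‖) {n : ℕ}
    (hn : Module.finrank ℂ V = n) :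
    ∃ e : V ≃ₗ[ℂ] EuclideanSpace ℂ (Fin n), ∀ x, ‖e x‖ = ‖A x‖ := by
  have hsmul (c : ℂ) (x : V) : ‖A (c • x)‖ = ‖c‖ * ‖A x‖ := by
    rcases eq_or_ne c 0 with rfl | hc
    · simp
    have hc' : (‖c‖ : ℂ) ≠ 0 := by simpa using hc
    have h : c • x = ‖c‖ • ((c / ‖c‖) • x) := by
      rw [← smul_assoc, Complex.real_smul, mul_div_cancel₀ _ hc']
    rw [h, map_smul, norm_smul, norm_norm, hA _ _ (by simp [hc])]
  let _ : NormedAddCommGroup V := NormedAddCommGroup.induced V F A hinj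
  have hnorm (x : V) : ‖x‖ = ‖A x‖ := rfl
  let _ : NormedSpace ℂ V := { norm_smul_le := fun c x => (hsmul c x).le }
  have : InnerProductSpaceable V := ⟨fun x y => by
    simpa only [hnorm, map_add, map_sub, sq] using parallelogram_law_with_norm ℝ (A x) (A y)⟩
  let _ : InnerProductSpace ℂ V :=
    InnerProductSpace.ofNorm ℂ InnerProductSpaceable.parallelogram_identity
  let b := (stdOrthonormalBasis ℂ V).reindex (finCongr hn)
  exact ⟨b.repr.toLinearEquiv, fun x => b.repr.norm_map x⟩

/-- If a centred unit ball is symmetric about a point, this point is its centre. -/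
theorem eq_zero_of_forall_norm_two_smul_sub_le {F : Type*} [NormedAddCommGroup F] [NormedSpace ℝ F]
    {d : F} (h : ∀ u : F, ‖u‖ ≤ 1 → ‖(2 : ℝ) • d - u‖ ≤ 1) : d = 0 := by
  by_contra hd
  have hpos : 0 < ‖d‖ := norm_pos_iff.2 hd
  have h1 := h (-(‖d‖⁻¹ • d)) (by simp [norm_smul, hpos.ne'])
  have h2 : (2 : ℝ) • d - -(‖d‖⁻¹ • d) = (2 + ‖d‖⁻¹) • d := by module
  rw [h2, norm_smul, Real.norm_of_nonneg (by positivity), add_mul, inv_mul_cancel₀ hpos.ne'] at h1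
  linarith

/-- A complex symmetric real ellipsoid in `ℂⁿ ≅ ℝ^{2n}` (`n ≥ 2`) is a complex
ellipsoid. -/
theorem complex_symmetric_real_ellipsoid_is_complex_ellipsoid (n : ℕ) (hn : 2 ≤ n)
    (K : Set (EuclideanSpace ℂ (Fin n)))
    (T : EuclideanSpace ℂ (Fin n) ≃ₗ[ℝ] EuclideanSpace ℂ (Fin n))
    (v : EuclideanSpace ℂ (Fin n))
    (hK : K = (fun x => T x + v) '' Metric.closedBall 0 1)
    (hsym : ∃ x₀ : EuclideanSpace ℂ (Fin n), ∀ ξ : ℂ, ‖ξ‖ = 1 →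
        ξ • ((fun x => x - x₀) '' K) = (fun x => x - x₀) '' K) :
    ∃ (S : EuclideanSpace ℂ (Fin n) ≃ₗ[ℂ] EuclideanSpace ℂ (Fin n))
      (w : EuclideanSpace ℂ (Fin n)),
      K = (fun x => S x + w) '' Metric.closedBall 0 1 := by
  obtain ⟨x₀, hsym⟩ := hsym
  have hmem (y) : y ∈ K ↔ ‖T.symm (y - v)‖ ≤ 1 := by
    rw [hK]
    constructor
    · rintro ⟨x, hx, rfl⟩
      simpa using hx
    · intro h
      exact ⟨T.symm (y - v), by simpa using h, by simp⟩
  have hrot (ξ : ℂ) (hξ : ‖ξ‖ = 1) (y) (hy : y ∈ K) : ξ • (y - x₀) + x₀ ∈ K := by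
    have h : ξ • (y - x₀) ∈ (fun x => x - x₀) '' K :=
      hsym ξ hξ ▸ Set.smul_mem_smul_set ⟨y, hy, rfl⟩
    obtain ⟨z, hz, hzy⟩ := h
    rw [← hzy]
    simpa using hz
  have hcentre : x₀ = v := by
    have h0 : T.symm (x₀ - v) = 0 := eq_zero_of_forall_norm_two_smul_sub_le fun u hu => by
      have h := (hmem _).1 (hrot (-1) (by simp) (T u + v) ((hmem _).2 (by simpa using hu)))
      have h2 : (-1 : ℂ) • (T u + v - x₀) + x₀ - v = (2 : ℝ) • (x₀ - v) - T u := by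
        rw [neg_one_smul, two_smul]
        abel
      rwa [h2, map_sub, map_smul, T.symm_apply_apply] at h
    exact sub_eq_zero.1 (T.symm.map_eq_zero_iff.1 h0)
  subst hcentre
  have hle (ξ : ℂ) (x) (hξ : ‖ξ‖ = 1) : ‖T.symm (ξ • x)‖ ≤ ‖T.symm x‖ := by
    rcases eq_or_ne x 0 with rfl | hx
    · simp
    have hpos : 0 < ‖T.symm x‖ := norm_pos_iff.2 (T.symm.map_ne_zero_iff.2 hx)
    have h := (hmem _).1 (hrot ξ hξ (‖T.symm x‖⁻¹ • x + x₀)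
      ((hmem _).2 (by simp [norm_smul, hpos.ne'])))
    rw [add_sub_cancel_right, add_sub_cancel_right, smul_comm, map_smul, norm_smul, norm_inv,
      norm_norm, inv_mul_le_iff₀ hpos, mul_one] at h
    exact h
  obtain ⟨e, he⟩ := exists_complexLinearEquiv_norm_eq T.symm.toLinearMap T.symm.injective
    (fun ξ x hξ => (hle ξ x hξ).antisymm (by
      have hξ0 : ξ ≠ 0 := norm_ne_zero_iff.1 (by simp [hξ])
      simpa [smul_smul, hξ0] using hle ξ⁻¹ (ξ • x) (by simp [hξ])))
    (finrank_euclideanSpace_fin (𝕜 := ℂ) (n := n))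
  refine ⟨e.symm, x₀, Set.ext fun y => ?_⟩
  have hey : ‖e (y - x₀)‖ = ‖T.symm (y - x₀)‖ := he _
  rw [hmem, ← hey]
  constructor
  · intro h
    exact ⟨e (y - x₀), by simpa using h, by simp⟩
  · rintro ⟨x, hx, rfl⟩
    simpa using hx
end

section
/- Let A ⊂ S³ (the unit sphere of ℂ²) be linearly closed: for any two distinct points x, y ∈ A, the intersection of S³ with the complex line through x and y is contained in A. If A is a proper nonempty subset of S³, then A is either a single point or the intersection of S³ with a single complex line of ℂ². -/
/-- A complex line in a complex vector space. -/
def IsComplexLine {V : Type*} [AddCommGroup V] [Module ℂ V] (L : Set V) : Prop :=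
  ∃ a b : V, b ≠ 0 ∧ L = {x | ∃ t : ℂ, x = a + t • b}

open scoped ComplexConjugate

section Siegel

variable {E : Type*} [NormedAddCommGroup E] [InnerProductSpace ℂ E] {e f : E}

/-- The boundary point, written as a complex number `w` with `Re w = ‖z‖ ^ 2`, of the
Siegel domain over `z` at height `u`. -/
noncomputable def siegelHeight (z : ℂ) (u : ℝ) : ℂ := ⟨‖z‖ ^ 2, u⟩

/-- Heisenberg coordinates on the unit sphere of the span of an orthonormal pair `e, f`,
with the point `e` sent to infinity. -/
noncomputable def heisenbergPoint (e f : E) (z : ℂ) (u : ℝ) : E :=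
  e + (2 / (siegelHeight z u + 1)) • (z • f - e)

theorem siegelHeight_add_one_ne_zero (z : ℂ) (u : ℝ) : siegelHeight z u + 1 ≠ 0 := by
  intro h
  have := congrArg Complex.re h
  simp only [siegelHeight, Complex.add_re, Complex.one_re, Complex.zero_re] at this
  linarith [sq_nonneg ‖z‖]

theorem norm_sq_smul_add_smul (he : ‖e‖ = 1) (hf : ‖f‖ = 1) (hef : inner ℂ e f = 0)
    (a b : ℂ) : ‖a • e + b • f‖ ^ 2 = ‖a‖ ^ 2 + ‖b‖ ^ 2 := by
  have h : inner ℂ (a • e) (b • f) = 0 := by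
    rw [inner_smul_left, inner_smul_right, hef]; simp
  have := norm_add_sq_eq_norm_sq_add_norm_sq_of_inner_eq_zero _ _ h
  simp only [norm_smul, he, hf, mul_one] at this
  linarith

theorem norm_heisenbergPoint (he : ‖e‖ = 1) (hf : ‖f‖ = 1) (hef : inner ℂ e f = 0)
    (z : ℂ) (u : ℝ) : ‖heisenbergPoint e f z u‖ = 1 := by
  have hw := siegelHeight_add_one_ne_zero z u
  have h : heisenbergPoint e f z u = ((siegelHeight z u - 1) / (siegelHeight z u + 1)) • e +
      (2 * z / (siegelHeight z u + 1)) • f := by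
    unfold heisenbergPoint
    match_scalars
    · field_simp
      ring
    · field_simp
  have hn : ‖heisenbergPoint e f z u‖ ^ 2 = 1 := by
    rw [h, norm_sq_smul_add_smul he hf hef]
    simp only [norm_div, norm_mul, div_pow, mul_pow]
    rw [← add_div, div_eq_one_iff_eq (by simpa using hw)]
    simp only [Complex.sq_norm, Complex.normSq_apply, siegelHeight, Complex.add_re,
      Complex.add_im, Complex.sub_re, Complex.sub_im, Complex.one_re, Complex.one_im,
      Complex.re_ofNat, Complex.im_ofNat]
    ring
  exact (sq_eq_sq₀ (norm_nonneg _) zero_le_one).1 (by simpa using hn)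

theorem exists_eq_heisenbergPoint (he : ‖e‖ = 1) (hf : ‖f‖ = 1) (hef : inner ℂ e f = 0)
    (hspan : ∀ x : E, ∃ a b : ℂ, x = a • e + b • f) {x : E} (hx : ‖x‖ = 1) (hxe : x ≠ e) :
    ∃ z u, x = heisenbergPoint e f z u := by
  obtain ⟨a, b, rfl⟩ := hspan x
  have hab : ‖a‖ ^ 2 + ‖b‖ ^ 2 = 1 := by
    rw [← norm_sq_smul_add_smul he hf hef, hx, one_pow]
  have ha : 1 - a ≠ 0 := by
    intro h
    have ha : a = 1 := (sub_eq_zero.1 h).symm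
    subst ha
    have hb : b = 0 := by simpa using hab
    simp [hb] at hxe
  have hw : siegelHeight (b / (1 - a)) ((1 + a) / (1 - a)).im = (1 + a) / (1 - a) := by
    apply Complex.ext
    · have hN : Complex.normSq (1 - a) ≠ 0 := by simpa using ha
      have hb : ‖b‖ ^ 2 = 1 - ‖a‖ ^ 2 := by linarith
      simp only [siegelHeight, norm_div, div_pow, hb, Complex.div_re]
      rw [Complex.sq_norm, Complex.sq_norm, ← add_div]
      congr 1
      simp [Complex.normSq_apply]
      ring
    · rfl
  refine ⟨b / (1 - a), ((1 + a) / (1 - a)).im, ?_⟩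
  have h2 : 2 / ((1 + a) / (1 - a) + 1) = 1 - a := by
    have : (1 + a) / (1 - a) + 1 = 2 / (1 - a) := by field_simp; ring
    rw [this]
    field_simp
  rw [heisenbergPoint, hw, h2]
  match_scalars <;> field_simp
  ring

theorem heisenbergPoint_eq_vertical (z : ℂ) (u v : ℝ) :
    ∃ t : ℂ, heisenbergPoint e f z v = e + t • (heisenbergPoint e f z u - e) := by
  have hu := siegelHeight_add_one_ne_zero z u
  have hv := siegelHeight_add_one_ne_zero z v
  refine ⟨(siegelHeight z u + 1) / (siegelHeight z v + 1), ?_⟩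
  rw [heisenbergPoint, heisenbergPoint, add_sub_cancel_left, smul_smul]
  congr 2
  field_simp

theorem heisenbergPoint_eq_of_affine {z z₁ z₂ c : ℂ} {u u₁ u₂ : ℝ}
    (hz : z = z₁ + c * (z₂ - z₁))
    (hw : siegelHeight z u =
      siegelHeight z₁ u₁ + c * (siegelHeight z₂ u₂ - siegelHeight z₁ u₁)) :
    ∃ t : ℂ, heisenbergPoint e f z u =
      heisenbergPoint e f z₁ u₁ +
        t • (heisenbergPoint e f z₂ u₂ - heisenbergPoint e f z₁ u₁) := by
  have h := siegelHeight_add_one_ne_zero z u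
  have h₁ := siegelHeight_add_one_ne_zero z₁ u₁
  have h₂ := siegelHeight_add_one_ne_zero z₂ u₂
  refine ⟨c * (siegelHeight z₂ u₂ + 1) / (siegelHeight z u + 1), ?_⟩
  unfold heisenbergPoint
  generalize siegelHeight z u = w at *
  generalize siegelHeight z₁ u₁ = w₁ at *
  generalize siegelHeight z₂ u₂ = w₂ at *
  subst hz
  match_scalars
  · field_simp
    rw [hw]
    ring
  · field_simp
    rw [hw]
    ring

theorem exists_heights_of_im_ne_zero {z z₁ z₂ c : ℂ} (hc : c.im ≠ 0) (u : ℝ) :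
    ∃ u₁ u₂ : ℝ, siegelHeight z u =
      siegelHeight z₁ u₁ + c * (siegelHeight z₂ u₂ - siegelHeight z₁ u₁) := by
  obtain ⟨d, hd⟩ : ∃ d : ℝ, ‖z‖ ^ 2 =
      ‖z₁‖ ^ 2 + (c.re * (‖z₂‖ ^ 2 - ‖z₁‖ ^ 2) - c.im * d) :=
    ⟨(‖z₁‖ ^ 2 + c.re * (‖z₂‖ ^ 2 - ‖z₁‖ ^ 2) - ‖z‖ ^ 2) / c.im, by field_simp; ring⟩
  refine ⟨u - c.re * d - c.im * (‖z₂‖ ^ 2 - ‖z₁‖ ^ 2),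
    u - c.re * d - c.im * (‖z₂‖ ^ 2 - ‖z₁‖ ^ 2) + d, ?_⟩
  apply Complex.ext
  · simp only [siegelHeight, Complex.add_re, Complex.mul_re, Complex.sub_re, Complex.sub_im]
    linarith
  · simp only [siegelHeight, Complex.add_im, Complex.mul_im, Complex.sub_re, Complex.sub_im]
    ring

/-- A set of points of `ℂ` containing, with two points, every point off the real line through
them, is everything as soon as it has two points. -/
theorem mem_of_forall_off_real_line {B : Set ℂ}
    (hB : ∀ z₁ ∈ B, ∀ z₂ ∈ B, ∀ c : ℂ, c.im ≠ 0 → z₁ + c * (z₂ - z₁) ∈ B)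
    {z₁ z₂ : ℂ} (h₁ : z₁ ∈ B) (h₂ : z₂ ∈ B) (h : z₁ ≠ z₂) (z : ℂ) : z ∈ B := by
  have hd : z₂ - z₁ ≠ 0 := sub_ne_zero.2 h.symm
  by_cases hz : z = z₁
  · rwa [hz]
  by_cases hc : ((z - z₁) / (z₂ - z₁)).im = 0
  · have h₃ := hB z₁ h₁ z₂ h₂ Complex.I (by simp)
    obtain ⟨r, hr⟩ : ∃ r : ℝ, (z - z₁) / (z₂ - z₁) = r :=
      ⟨_, Complex.ext rfl (by simpa using hc)⟩
    have hr' : z = z₁ + r * (z₂ - z₁) := by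
      rw [← hr]; field_simp; ring
    have hr0 : r ≠ 0 := by
      rintro rfl
      exact hz (by simpa using hr')
    have := hB z₁ h₁ _ h₃ (-(r * Complex.I)) (by simpa using hr0)
    convert this using 1
    rw [hr']
    linear_combination ((r : ℂ) * (z₂ - z₁)) * Complex.I_sq
  · have := hB z₁ h₁ z₂ h₂ _ hc
    rwa [div_mul_cancel₀ _ hd, add_sub_cancel] at this

theorem linearly_closed_of_orthonormal_pair (he : ‖e‖ = 1) (hf : ‖f‖ = 1)
    (hef : inner ℂ e f = 0) (hspan : ∀ x : E, ∃ a b : ℂ, x = a • e + b • f)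
    {A : Set E} (hAS : A ⊆ Metric.sphere 0 1) (heA : e ∈ A)
    (hproper : A ≠ Metric.sphere 0 1)
    (hA : ∀ x ∈ A, ∀ y ∈ A, ∀ t : ℂ, ‖x + t • (y - x)‖ = 1 → x + t • (y - x) ∈ A) :
    A = {e} ∨ ∃ L : Set E, IsComplexLine L ∧ A = L ∩ Metric.sphere 0 1 := by
  have hnorm := norm_heisenbergPoint he hf hef
  have vertical {z : ℂ} {u : ℝ} (h : heisenbergPoint e f z u ∈ A) (v : ℝ) :
      heisenbergPoint e f z v ∈ A := by
    obtain ⟨t, ht⟩ := heisenbergPoint_eq_vertical (e := e) (f := f) z u v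
    rw [ht]
    exact hA _ heA _ h t (ht ▸ hnorm z v)
  by_cases hAe : A = {e}
  · exact Or.inl hAe
  right
  obtain ⟨q, hq, hqe⟩ : ∃ q ∈ A, q ≠ e := by
    by_contra! h
    exact hAe (Set.eq_singleton_iff_unique_mem.2 ⟨heA, h⟩)
  obtain ⟨z₀, u₀, rfl⟩ := exists_eq_heisenbergPoint he hf hef hspan
    (mem_sphere_zero_iff_norm.1 (hAS hq)) hqe
  have hne : heisenbergPoint e f z₀ u₀ - e ≠ 0 := sub_ne_zero.2 hqe
  refine ⟨_, ⟨e, heisenbergPoint e f z₀ u₀ - e, hne, rfl⟩, ?_⟩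
  apply Set.Subset.antisymm
  · refine fun x hx => ⟨?_, hAS hx⟩
    by_cases hxe : x = e
    · exact ⟨0, by simp [hxe]⟩
    obtain ⟨z, u, rfl⟩ := exists_eq_heisenbergPoint he hf hef hspan
      (mem_sphere_zero_iff_norm.1 (hAS hx)) hxe
    suffices h : z₀ = z by
      subst h
      exact heisenbergPoint_eq_vertical z₀ u₀ u
    by_contra hz
    refine hproper (hAS.antisymm fun y hy => ?_)
    by_cases hye : y = e
    · rwa [hye]
    obtain ⟨z', u', rfl⟩ := exists_eq_heisenbergPoint he hf hef hspan
      (mem_sphere_zero_iff_norm.1 hy) hye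
    refine mem_of_forall_off_real_line (B := {z | ∀ u, heisenbergPoint e f z u ∈ A})
      ?_ (vertical hq) (vertical hx) hz z' u'
    intro z₁ h₁ z₂ h₂ c hc v
    obtain ⟨u₁, u₂, hu⟩ := exists_heights_of_im_ne_zero (z := z₁ + c * (z₂ - z₁))
      (z₁ := z₁) (z₂ := z₂) hc v
    obtain ⟨t, ht⟩ := heisenbergPoint_eq_of_affine (e := e) (f := f) rfl hu
    rw [ht]
    exact hA _ (h₁ u₁) _ (h₂ u₂) t (ht ▸ hnorm _ v)
  · rintro x ⟨⟨t, rfl⟩, hx⟩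
    exact hA _ heA _ hq t (mem_sphere_zero_iff_norm.1 hx)

end Siegel

theorem exists_orthonormal_complement {p : EuclideanSpace ℂ (Fin 2)} (hp : ‖p‖ = 1) :
    ∃ f : EuclideanSpace ℂ (Fin 2), ‖f‖ = 1 ∧ inner ℂ p f = 0 ∧
      ∀ x : EuclideanSpace ℂ (Fin 2), ∃ a b : ℂ, x = a • p + b • f := by
  have hp2 : ‖p 0‖ ^ 2 + ‖p 1‖ ^ 2 = 1 := by
    simpa [hp] using (EuclideanSpace.norm_sq_eq p).symm
  have hpc : p 0 * conj (p 0) + p 1 * conj (p 1) = 1 := by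
    rw [Complex.mul_conj', Complex.mul_conj']
    simpa using congrArg Complex.ofReal hp2
  refine ⟨!₂[-conj (p 1), conj (p 0)], ?_, ?_, fun x => ?_⟩
  · rw [EuclideanSpace.norm_eq]
    simp [add_comm, hp2]
  · simp [PiLp.inner_apply, Fin.sum_univ_two]
    ring
  · refine ⟨conj (p 0) * x 0 + conj (p 1) * x 1, p 0 * x 1 - p 1 * x 0, ?_⟩
    ext i
    fin_cases i
    · simp
      linear_combination (-x 0) * hpc
    · simp
      linear_combination (-x 1) * hpc

/-- A proper nonempty linearly closed subset of `S³` is a single point or the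
intersection of `S³` with a complex line. -/
theorem linearly_closed_subsets_of_sphere
    (A : Set (EuclideanSpace ℂ (Fin 2)))
    (hAS : A ⊆ Metric.sphere 0 1) (hAne : A.Nonempty)
    (hproper : A ≠ Metric.sphere 0 1)
    (hclosed : ∀ x ∈ A, ∀ y ∈ A, x ≠ y →
      ∀ L : Set (EuclideanSpace ℂ (Fin 2)), IsComplexLine L → x ∈ L → y ∈ L →
        L ∩ Metric.sphere 0 1 ⊆ A) :
    (∃ p, A = {p}) ∨
      (∃ L : Set (EuclideanSpace ℂ (Fin 2)), IsComplexLine L ∧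
        A = L ∩ Metric.sphere 0 1) := by
  obtain ⟨p, hpA⟩ := hAne
  have hp : ‖p‖ = 1 := mem_sphere_zero_iff_norm.1 (hAS hpA)
  obtain ⟨f, hf, hpf, hspan⟩ := exists_orthonormal_complement hp
  refine (linearly_closed_of_orthonormal_pair hp hf hpf hspan hAS hpA hproper ?_).imp_left
    fun h => ⟨p, h⟩
  intro x hx y hy t ht
  by_cases hxy : x = y
  · simpa [← hxy] using hx
  · exact hclosed x hx y hy hxy _ ⟨x, y - x, sub_ne_zero.2 (Ne.symm hxy), rfl⟩
      ⟨0, by simp⟩ ⟨1, by simp⟩ ⟨⟨t, rfl⟩, mem_sphere_zero_iff_norm.2 ht⟩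
end

section
/- A convex body K ⊂ ℂⁿ is a complex ellipsoid if and only if for every complex line L ⊂ ℂⁿ, the section L ∩ K is either empty, a single point, or a disk (image of a round closed disk under a complex affine identification L ≅ ℂ). -/
/-- A disk: image of a closed round disk under a complex affine map `ℂ → V`. -/
def IsComplexDisk {V : Type*} [AddCommGroup V] [Module ℂ V] (S : Set V) : Prop :=
  ∃ (a b : V) (r : ℝ), 0 < r ∧ b ≠ 0 ∧
    S = (fun t : ℂ => a + t • b) '' Metric.closedBall (0 : ℂ) r

open Metric ComplexConjugate

theorem Complex.exists_closedBall_eq_quadratic_sublevel {k : ℝ} (hk : 0 < k) (a : ℂ) (c : ℝ) :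
    ∃ (m : ℂ) (r : ℝ), {t : ℂ | k * ‖t‖ ^ 2 + (a * t).re + c ≤ 0} = closedBall m r := by
  have key (t : ℂ) : k * ‖t‖ ^ 2 + (a * t).re + c
      = k * (‖t + conj a / (2 * k : ℝ)‖ ^ 2 - (‖a‖ ^ 2 / (4 * k ^ 2) - c / k)) := by
    simp only [Complex.sq_norm, Complex.normSq_apply, Complex.add_re, Complex.add_im,
      Complex.div_ofReal_re, Complex.div_ofReal_im, Complex.conj_re, Complex.conj_im,
      Complex.mul_re]
    field_simp
    ring
  refine ⟨-(conj a / (2 * k : ℝ)), if 0 ≤ ‖a‖ ^ 2 / (4 * k ^ 2) - c / k then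
    √(‖a‖ ^ 2 / (4 * k ^ 2) - c / k) else -1, ?_⟩
  ext t
  rw [Set.mem_ofPred_eq, key, mem_closedBall, dist_eq_norm, sub_neg_eq_add]
  split_ifs with h
  · rw [Real.le_sqrt (norm_nonneg _) h]
    constructor
    · intro h1
      by_contra h2
      have := mul_pos hk (sub_pos.2 (not_le.1 h2))
      linarith
    · intro h1
      exact mul_nonpos_of_nonneg_of_nonpos hk.le (by linarith)
  · constructor
    · intro h1
      have : 0 < k * (‖t + conj a / (2 * k : ℝ)‖ ^ 2 - (‖a‖ ^ 2 / (4 * k ^ 2) - c / k)) := by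
        apply mul_pos hk
        have := sq_nonneg ‖t + conj a / (2 * k : ℝ)‖
        linarith [not_le.1 h]
      linarith
    · intro h1
      linarith [norm_nonneg (t + conj a / (2 * k : ℝ))]

section AffineSublevel

variable {f : ℂ → ℝ}

/-- Every sublevel set of `f` relative to a real affine function is a closed disk,
a point or empty. -/
def HasBallAffineSublevels (f : ℂ → ℝ) : Prop :=
  ∀ (a : ℂ) (c : ℝ), ∃ (m : ℂ) (r : ℝ), {s | f s ≤ (a * s).re + c} = closedBall m r

theorem Complex.exists_affine_interpolation (f : ℂ → ℝ) {x y : ℂ} (hxy : x ≠ y) :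
    ∃ (a : ℂ) (c : ℝ), f x = (a * x).re + c ∧ f y = (a * y).re + c := by
  have h : y - x ≠ 0 := sub_ne_zero.2 hxy.symm
  refine ⟨((f y - f x : ℝ) : ℂ) / (y - x), f x - (((f y - f x : ℝ) : ℂ) / (y - x) * x).re, ?_, ?_⟩
  · ring
  · have : ((f y - f x : ℝ) : ℂ) / (y - x) * y
        = ((f y - f x : ℝ) : ℂ) + ((f y - f x : ℝ) : ℂ) / (y - x) * x := by
      field_simp
      ring
    rw [this, Complex.add_re, Complex.ofReal_re]
    ring

theorem HasBallAffineSublevels.convexOn (hf : HasBallAffineSublevels f) :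
    ConvexOn ℝ Set.univ f := by
  refine ⟨convex_univ, fun x _ y _ α β hα hβ hαβ => ?_⟩
  rcases eq_or_ne x y with rfl | hxy
  · rw [← add_smul, ← add_smul, hαβ, one_smul, one_smul]
  obtain ⟨a, c, hx, hy⟩ := Complex.exists_affine_interpolation f hxy
  obtain ⟨m, r, hS⟩ := hf a c
  have hx' : x ∈ closedBall m r := hS ▸ hx.le
  have hy' : y ∈ closedBall m r := hS ▸ hy.le
  have h := convex_closedBall m r hx' hy' hα hβ hαβ
  rw [← hS] at h
  refine h.trans (le_of_eq ?_)
  rw [hx, hy]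
  simp only [Complex.real_smul, Complex.mul_re, Complex.add_re, Complex.add_im, Complex.mul_im,
    Complex.ofReal_re, Complex.ofReal_im, smul_eq_mul]
  linear_combination -c * hαβ

theorem HasBallAffineSublevels.continuous (hf : HasBallAffineSublevels f) : Continuous f := by
  rw [← continuousOn_univ]
  exact hf.convexOn.continuousOn isOpen_univ

theorem HasBallAffineSublevels.eq_of_dist_eq (hf : HasBallAffineSublevels f) {a m z : ℂ} {c r : ℝ}
    (hS : {s | f s ≤ (a * s).re + c} = closedBall m r) (hr : 0 < r) (hz : dist z m = r) :
    f z = (a * z).re + c := by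
  have hz' : z ∈ {s | f s ≤ (a * s).re + c} := by rw [hS]; exact hz.le
  refine le_antisymm hz' (not_lt.1 fun hlt => ?_)
  have hopen : IsOpen {s | f s < (a * s).re + c} :=
    isOpen_lt hf.continuous (by fun_prop)
  have hsub : {s | f s < (a * s).re + c} ⊆ closedBall m r := by
    rw [← hS]
    exact Set.ofPred_subset_ofPred.2 fun s hs => hs.le
  have := interior_maximal hsub hopen hlt
  rw [interior_closedBall m hr.ne', mem_ball] at this
  exact this.ne hz

theorem HasBallAffineSublevels.dist_eq_of_eq (hf : HasBallAffineSublevels f) {a m z : ℂ} {c r : ℝ}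
    (hS : {s | f s ≤ (a * s).re + c} = closedBall m r) (hz : f z = (a * z).re + c) :
    dist z m = r := by
  have hmem (w : ℂ) : f w ≤ (a * w).re + c ↔ dist w m ≤ r := by
    rw [← mem_closedBall, ← hS, Set.mem_ofPred_eq]
  refine le_antisymm ((hmem z).1 hz.le) (not_lt.1 fun hlt => ?_)
  set δ := r - dist z m with hδ
  have hδ0 : 0 < δ := sub_pos.2 hlt
  have hnear (w : ℂ) (hw : ‖w‖ ≤ δ) : f (z + w) ≤ (a * (z + w)).re + c := by
    rw [hmem]
    have := dist_triangle (z + w) z m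
    rw [dist_self_add_left] at this
    linarith
  obtain ⟨m', r', hS'⟩ := hf (a + 1) (c - z.re)
  have hmem' (w : ℂ) : f w ≤ ((a + 1) * w).re + (c - z.re) ↔ dist w m' ≤ r' := by
    rw [← mem_closedBall, ← hS', Set.mem_ofPred_eq]
  have h1 : dist (z + δ * Complex.I) m' ≤ r' := by
    rw [← hmem']
    have := hnear (δ * Complex.I) (by simp [abs_of_pos hδ0])
    simp only [add_mul, one_mul, Complex.add_re, Complex.mul_re, Complex.ofReal_re, Complex.ofReal_im,
      Complex.I_re, Complex.I_im] at this ⊢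
    linarith
  have h2 : dist (z + -(δ * Complex.I)) m' ≤ r' := by
    rw [← hmem']
    have := hnear (-(δ * Complex.I)) (by simp [abs_of_pos hδ0])
    simp only [add_mul, one_mul, Complex.add_re, Complex.mul_re, Complex.ofReal_re, Complex.ofReal_im,
      Complex.I_re, Complex.I_im, Complex.neg_re] at this ⊢
    linarith
  have hr' : 0 ≤ r' := dist_nonneg.trans h1
  have h3 : dist z m' < r' := by
    rw [dist_eq_norm] at h1 h2 ⊢
    refine lt_of_pow_lt_pow_left₀ 2 hr' ?_
    have h1' := pow_le_pow_left₀ (norm_nonneg _) h1 2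
    have h2' := pow_le_pow_left₀ (norm_nonneg _) h2 2
    simp only [Complex.sq_norm, Complex.normSq_apply, Complex.add_re, Complex.add_im,
      Complex.sub_re, Complex.sub_im, Complex.mul_re, Complex.mul_im, Complex.ofReal_re,
      Complex.ofReal_im, Complex.I_re, Complex.I_im, Complex.neg_re, Complex.neg_im] at h1' h2' ⊢
    nlinarith
  set ε := min δ (r' - dist z m') with hε
  have hε0 : 0 < ε := lt_min hδ0 (sub_pos.2 h3)
  have h4 : f (z + -(ε : ℂ)) ≤ ((a + 1) * (z + -(ε : ℂ))).re + (c - z.re) := by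
    rw [hmem']
    have := dist_triangle (z + -(ε : ℂ)) z m'
    rw [dist_self_add_left, norm_neg, Complex.norm_real, Real.norm_of_nonneg hε0.le] at this
    linarith [min_le_right δ (r' - dist z m')]
  have h5 := hnear (ε : ℂ) (by
    rw [Complex.norm_real, Real.norm_of_nonneg hε0.le]; exact min_le_left _ _)
  have h6 := hf.convexOn.2 (Set.mem_univ (z + (ε : ℂ))) (Set.mem_univ (z + -(ε : ℂ)))
    (by norm_num : (0 : ℝ) ≤ 1 / 2) (by norm_num : (0 : ℝ) ≤ 1 / 2) (by norm_num)
  have h7 : (1 / 2 : ℝ) • (z + (ε : ℂ)) + (1 / 2 : ℝ) • (z + -(ε : ℂ)) = z := by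
    rw [← smul_add, show z + (ε : ℂ) + (z + -(ε : ℂ)) = (2 : ℝ) • z by
      rw [two_smul]; ring, smul_smul]
    norm_num
  rw [h7, hz] at h6
  simp only [add_mul, one_mul, Complex.add_re, Complex.mul_re, Complex.ofReal_re, Complex.ofReal_im,
    Complex.neg_re, Complex.neg_im, Complex.add_im, smul_eq_mul] at h4 h5 h6
  nlinarith

theorem Complex.exists_chord_of_circle {ζ : ℂ} (hζ : ζ ≠ 0) {ρ : ℝ} (hρ : 0 < ρ) :
    ∃ e e₁ e₂ : ℂ, (e * ζ).re = ‖ζ‖ ^ 2 ∧ ‖e₁‖ = ρ ∧ ‖e₂‖ = ρ ∧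
      (e * e₁).re = ρ ^ 2 ∧ (e * e₂).re = ρ ^ 2 ∧
      ∀ n : ℂ, (n * e₁).re = ρ ^ 2 → (n * e₂).re = ρ ^ 2 → n = e := by
  have hζ' : 0 < ‖ζ‖ := norm_pos_iff.2 hζ
  set e : ℂ := conj ζ * (1 + (ρ / ‖ζ‖ : ℝ) * Complex.I) with he
  set j : ℝ := ‖ζ‖ / ρ with hj
  have hj0 : 0 < j := by positivity
  have hnorm (x : ℝ) : ‖(1 : ℂ) + x * Complex.I‖ ^ 2 = 1 + x ^ 2 := by
    rw [Complex.sq_norm, Complex.normSq_apply]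
    simp
    ring
  have hen : ‖e‖ ^ 2 = ρ ^ 2 * (1 + j ^ 2) := by
    rw [he, norm_mul, mul_pow, hnorm, RCLike.norm_conj, hj]
    field_simp
    ring
  have he0 : e ≠ 0 := by
    rw [← norm_ne_zero_iff, ← sq_pos_iff, hen]
    positivity
  have hpt (x : ℝ) (hx : x ^ 2 = j ^ 2) : ‖(ρ : ℂ) ^ 2 * (1 + x * Complex.I) / e‖ = ρ := by
    rw [← sq_eq_sq₀ (norm_nonneg _) hρ.le, norm_div, norm_mul, div_pow, mul_pow, hnorm, hen, hx,
      norm_pow, Complex.norm_real, Real.norm_of_nonneg hρ.le]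
    field_simp
  have hre (n : ℂ) (x : ℝ) : (n * ((ρ : ℂ) ^ 2 * (1 + x * Complex.I) / e)).re
      = ρ ^ 2 * ((n / e).re - x * (n / e).im) := by
    rw [show n * ((ρ : ℂ) ^ 2 * (1 + x * Complex.I) / e)
      = ((ρ ^ 2 : ℝ) : ℂ) * ((1 + x * Complex.I) * (n / e)) by push_cast; ring,
      Complex.re_ofReal_mul]
    simp
  refine ⟨e, _, _, ?_, hpt j rfl, hpt (-j) (neg_sq j), ?_, ?_, ?_⟩
  · rw [he, show conj ζ * (1 + (ρ / ‖ζ‖ : ℝ) * Complex.I) * ζ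
      = (conj ζ * ζ) * (1 + (ρ / ‖ζ‖ : ℝ) * Complex.I) by ring, Complex.conj_mul', ← Complex.ofReal_pow,
      Complex.re_ofReal_mul]
    simp
  · rw [hre, div_self he0]; simp
  · rw [hre, div_self he0]; simp
  · intro n h1 h2
    rw [hre] at h1 h2
    have hρ2 : ρ ^ 2 ≠ 0 := by positivity
    have h1' : (n / e).re - j * (n / e).im = 1 := mul_left_cancel₀ hρ2 (by rw [h1, mul_one])
    have h2' : (n / e).re - (-j) * (n / e).im = 1 := mul_left_cancel₀ hρ2 (by rw [h2, mul_one])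
    have him : (n / e).im = 0 := by
      have : j * (n / e).im = 0 := by linarith
      exact (mul_eq_zero.1 this).resolve_left hj0.ne'
    rw [him] at h1'
    rw [← div_eq_one_iff_eq he0]
    exact Complex.ext (by simpa using h1') (by simpa using him)

/-- A function whose affine sublevel sets are all disks is a rotationally symmetric quadratic. -/
theorem HasBallAffineSublevels.exists_eq_quadratic (hf : HasBallAffineSublevels f) :
    ∃ (q : ℝ) (a : ℂ) (c : ℝ), 0 < q ∧ ∀ s, f s = q * ‖s‖ ^ 2 + (a * s).re + c := by
  obtain ⟨a, c, h0, h1⟩ := Complex.exists_affine_interpolation f (zero_ne_one (α := ℂ))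
  obtain ⟨m, ρ, hS⟩ := hf a c
  have hmem (w : ℂ) : f w ≤ (a * w).re + c ↔ dist w m ≤ ρ := by
    rw [← mem_closedBall, ← hS, Set.mem_ofPred_eq]
  have hρ : 0 < ρ := by
    have h0' := (hmem 0).1 h0.le
    have h1' := (hmem 1).1 h1.le
    have := dist_triangle_right (0 : ℂ) 1 m
    rw [dist_zero_left, norm_one] at this
    linarith
  have hm : f m < (a * m).re + c := by
    refine lt_of_le_of_ne ((hmem m).2 (by simpa using hρ.le)) fun h => ?_
    have := hf.dist_eq_of_eq hS h
    rw [dist_self] at this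
    exact hρ.ne this
  set κ : ℝ := ((a * m).re + c - f m) / ρ ^ 2 with hκ
  have hκ0 : 0 < κ := div_pos (sub_pos.2 hm) (by positivity)
  have hκρ : κ * ρ ^ 2 = (a * m).re + c - f m := by rw [hκ]; field_simp
  suffices h : ∀ z, f z = (a * z).re + c + κ * (‖z - m‖ ^ 2 - ρ ^ 2) by
    refine ⟨κ, a - (2 * κ : ℝ) * conj m, c + κ * (‖m‖ ^ 2 - ρ ^ 2), hκ0, fun s => ?_⟩
    rw [h s]
    simp only [Complex.sq_norm, Complex.normSq_apply, Complex.sub_re, Complex.sub_im,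
      Complex.mul_re, Complex.mul_im, Complex.ofReal_re, Complex.ofReal_im, Complex.conj_re,
      Complex.conj_im]
    ring
  intro z
  rcases eq_or_ne z m with rfl | hz
  · rw [sub_self, norm_zero]
    linarith
  obtain ⟨e, e₁, e₂, heζ, hn1, hn2, he1, he2, huniq⟩ :=
    Complex.exists_chord_of_circle (sub_ne_zero.2 hz) hρ
  obtain ⟨m', r', hS'⟩ := hf (a + κ * e) (c - κ * ((e * m).re + ρ ^ 2))
  have heval (w : ℂ) : ((a + κ * e) * w).re + (c - κ * ((e * m).re + ρ ^ 2))
      = (a * w).re + c + κ * ((e * (w - m)).re - ρ ^ 2) := by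
    rw [add_mul, mul_assoc, Complex.add_re, Complex.re_ofReal_mul, mul_sub e, Complex.sub_re]
    ring
  have hd1 : dist (m + e₁) m' = r' := by
    apply hf.dist_eq_of_eq hS'
    rw [heval, hf.eq_of_dist_eq hS hρ (by simpa using hn1), add_sub_cancel_left, he1]
    ring
  have hd2 : dist (m + e₂) m' = r' := by
    apply hf.dist_eq_of_eq hS'
    rw [heval, hf.eq_of_dist_eq hS hρ (by simpa using hn2), add_sub_cancel_left, he2]
    ring
  have hd0 : dist m m' = r' := by
    apply hf.dist_eq_of_eq hS'
    rw [heval, sub_self, mul_zero, Complex.zero_re]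
    linarith
  have hr' : 0 < r' := by
    have := dist_triangle_right (m + e₁) m m'
    rw [dist_self_add_left, hn1] at this
    linarith
  rw [dist_eq_norm] at hd0 hd1 hd2
  have expand (w : ℂ) : ‖m + w - m'‖ ^ 2 = ‖w‖ ^ 2 - (2 * conj (m' - m) * w).re + ‖m - m'‖ ^ 2 := by
    simp only [Complex.sq_norm, Complex.normSq_apply, Complex.add_re, Complex.add_im,
      Complex.sub_re, Complex.sub_im, Complex.mul_re, Complex.mul_im, Complex.conj_re,
      Complex.conj_im, Complex.re_ofNat, Complex.im_ofNat]
    ring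
  have hn : 2 * conj (m' - m) = e := by
    apply huniq
    · have := expand e₁
      rw [hd1, hd0, hn1] at this
      linarith
    · have := expand e₂
      rw [hd2, hd0, hn2] at this
      linarith
  have hdz : dist z m' = r' := by
    have := expand (z - m)
    rw [hn, heζ, add_sub_cancel, hd0] at this
    rw [dist_eq_norm, ← sq_eq_sq₀ (norm_nonneg _) hr'.le]
    linarith
  rw [hf.eq_of_dist_eq hS' hr' hdz, heval, heζ]

end AffineSublevel

section LineSections

variable {E : Type*} [NormedAddCommGroup E] [NormedSpace ℂ E] {K : Set E} {l : E →ₗ[ℂ] ℂ}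

/-- Every section of `K` by a complex line is a closed disk, a point or empty. -/
def HasBallLineSections (K : Set E) : Prop :=
  ∀ a b : E, b ≠ 0 → ∃ (m : ℂ) (r : ℝ), {t : ℂ | a + t • b ∈ K} = closedBall m r

theorem HasBallLineSections.exists_radius (hK : HasBallLineSections K) (h0 : 0 ∈ K)
    (hl : ∀ x ∈ K, ‖x‖ ^ 2 ≤ 2 * (l x).re) {v : E} (hv : l v = 1) :
    ∃ r : ℝ, 0 ≤ r ∧ ∀ t : ℂ, t • v ∈ K ↔ ‖t‖ ^ 2 ≤ 2 * r * t.re := by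
  have hv0 : v ≠ 0 := by
    rintro rfl
    simp at hv
  obtain ⟨m, r, hS⟩ := hK 0 v hv0
  have hmem (t : ℂ) : t • v ∈ K ↔ ‖t - m‖ ≤ r := by
    rw [← dist_eq_norm, ← mem_closedBall, ← hS, Set.mem_ofPred_eq, zero_add]
  have hmr : ‖m‖ ≤ r := by simpa [h0] using hmem 0
  have hr : 0 ≤ r := (norm_nonneg m).trans hmr
  have hre : r ≤ m.re := by
    have h1 : (m - r) • v ∈ K := by
      rw [hmem]
      simp [abs_of_nonneg hr]
    have h2 := (sq_nonneg _).trans (hl _ h1)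
    rw [map_smul, hv, smul_eq_mul, mul_one, Complex.sub_re, Complex.ofReal_re] at h2
    linarith
  have hm2 := pow_le_pow_left₀ (norm_nonneg m) hmr 2
  rw [Complex.sq_norm, Complex.normSq_apply] at hm2
  have him : m.im = 0 := by nlinarith [mul_self_nonneg m.im]
  have hre' : m.re = r := by nlinarith
  refine ⟨r, hr, fun t => ?_⟩
  rw [hmem, ← sq_le_sq₀ (norm_nonneg _) hr]
  simp only [Complex.sq_norm, Complex.normSq_apply, Complex.sub_re, Complex.sub_im, him, hre']
  constructor <;> intro h <;> linarith

theorem radius_pos_of_norm_sq_le {r : ℝ} {v : E} {t₀ : ℂ} (ht₀ : t₀ ≠ 0)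
    (hr : ∀ t : ℂ, t • v ∈ K ↔ ‖t‖ ^ 2 ≤ 2 * r * t.re) (hr0 : 0 ≤ r) (h : t₀ • v ∈ K) :
    0 < r := by
  refine hr0.lt_of_ne' ?_
  rintro rfl
  have := (hr t₀).1 h
  rw [mul_zero, zero_mul] at this
  exact (pow_pos (norm_pos_iff.2 ht₀) 2).not_ge this

/-- Sections through the contact point which are transversal to the supporting hyperplane are not
degenerate. -/
theorem HasBallLineSections.exists_smul_mem (hK : HasBallLineSections K) (h0 : 0 ∈ K)
    (hconv : Convex ℝ K) (hl : ∀ x ∈ K, ‖x‖ ^ 2 ≤ 2 * (l x).re) {o : E} (ho : o ∈ interior K)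
    (ho0 : o ≠ 0) {v : E} (hv : l v = 1) : ∃ t : ℂ, t ≠ 0 ∧ t • v ∈ K := by
  have hlo : l o ≠ 0 := by
    intro h
    have := hl o (interior_subset ho)
    rw [h, Complex.zero_re, mul_zero] at this
    exact (pow_pos (norm_pos_iff.2 ho0) 2).not_ge this
  set v₁ : E := (l o)⁻¹ • o with hv₁
  have hlv₁ : l v₁ = 1 := by rw [hv₁, map_smul, smul_eq_mul, inv_mul_cancel₀ hlo]
  set h : E := v - v₁ with hh
  have hlh : l h = 0 := by rw [hh, map_sub, hv, hlv₁, sub_self]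
  have hnear (b : E) : ∀ᶠ δ : ℝ in nhds 0, o + (δ : ℂ) • b ∈ K := by
    have hc : Continuous fun δ : ℝ => o + (δ : ℂ) • b := by fun_prop
    have := hc.continuousAt.preimage_mem_nhds (x := 0)
      (t := K) (by simpa using mem_interior_iff_mem_nhds.1 ho)
    exact this
  obtain ⟨δ, ⟨hδ1, hδ2, hδ⟩, hδ0⟩ := (((hnear (l o • h)).and ((hnear (l o • Complex.I • h)).and
    (gt_mem_nhds (zero_lt_one (α := ℝ))))).filter_mono nhdsWithin_le_nhds |>.and
    (self_mem_nhdsWithin (s := Set.Ioi (0 : ℝ)))).exists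
  have hδ0 : 0 < δ := hδ0
  have hkey (b : E) (hb : l b = 0) (hbK : o + (δ : ℂ) • l o • b ∈ K) :
      ∃ r : ℝ, 0 < r ∧ ∀ t : ℂ, t • (v₁ + (δ : ℂ) • b) ∈ K ↔ ‖t‖ ^ 2 ≤ 2 * r * t.re := by
    have hlb : l (v₁ + (δ : ℂ) • b) = 1 := by
      rw [map_add, hlv₁, map_smul, hb, smul_zero, add_zero]
    obtain ⟨r, hr0, hr⟩ := hK.exists_radius h0 hl hlb
    refine ⟨r, radius_pos_of_norm_sq_le hlo hr hr0 ?_, hr⟩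
    rwa [smul_add, hv₁, smul_inv_smul₀ hlo, smul_comm]
  obtain ⟨r₁, hr₁, hr₁'⟩ := hkey h hlh hδ1
  obtain ⟨r₂, hr₂, hr₂'⟩ := hkey (Complex.I • h) (by rw [map_smul, hlh, smul_zero]) hδ2
  set D : ℝ := δ⁻¹ with hD
  have hD1 : 1 < D := (one_lt_inv₀ hδ0).2 hδ
  have hsmall (r : ℝ) (hr : 0 < r) (w : ℂ) (hw : 0 < w.re) :
      ∀ᶠ ε : ℝ in nhds 0, ‖w‖ ^ 2 * ε ≤ 2 * r * w.re := by
    have hc : Continuous fun ε : ℝ => ‖w‖ ^ 2 * ε := by fun_prop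
    have : ∀ᶠ ε : ℝ in nhds 0, ‖w‖ ^ 2 * ε < 2 * r * w.re :=
      hc.continuousAt.eventually_lt continuousAt_const (by simpa using by positivity)
    exact this.mono fun _ h => h.le
  set μ : ℂ := ((D + 1 : ℝ) + (D - 1 : ℝ) * Complex.I) / 2 with hμ
  set κ : ℂ := (D - 1 : ℝ) + (D : ℝ) * Complex.I with hκ
  have hw₁ : 0 < (κ * μ).re := by
    have : (κ * μ).re = (D - 1) / 2 := by
      simp [hκ, hμ]
      ring
    rw [this]
    linarith
  have hw₂ : 0 < (κ * (1 - μ)).re := by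
    have : (κ * (1 - μ)).re = (D - 1) / 2 := by
      simp [hκ, hμ]
      ring
    rw [this]
    linarith
  obtain ⟨ε, ⟨hε1, hε2⟩, hε0⟩ := (((hsmall r₁ hr₁ _ hw₁).and
    (hsmall r₂ hr₂ _ hw₂)).filter_mono nhdsWithin_le_nhds |>.and
    (self_mem_nhdsWithin (s := Set.Ioi (0 : ℝ)))).exists
  have hε0 : 0 < ε := hε0
  have hscale (r : ℝ) (w : ℂ) (hw : ‖w‖ ^ 2 * ε ≤ 2 * r * w.re) :
      ‖(ε : ℂ) * w‖ ^ 2 ≤ 2 * r * ((ε : ℂ) * w).re := by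
    rw [Complex.re_ofReal_mul, norm_mul, Complex.norm_real, Real.norm_of_nonneg hε0.le, mul_pow]
    nlinarith [mul_le_mul_of_nonneg_left hw hε0.le]
  have hm := hconv ((hr₁' _).2 (hscale _ _ hε1)) ((hr₂' _).2 (hscale _ _ hε2))
    (by norm_num : (0 : ℝ) ≤ 1 / 2) (by norm_num : (0 : ℝ) ≤ 1 / 2) (by norm_num)
  have hκ0 : κ ≠ 0 := by
    rintro hκ0
    rw [hκ0, zero_mul, Complex.zero_re] at hw₁
    exact lt_irrefl _ hw₁
  refine ⟨(1 / 2 : ℝ) * (ε * κ), by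
    simp [hκ0, hε0.ne'], ?_⟩
  convert hm using 1
  have hvh : v = v₁ + h := by rw [hh]; abel
  have hcomb : μ * (δ : ℂ) + (1 - μ) * (δ * Complex.I) = 1 := by
    have hδc : (δ : ℂ) ≠ 0 := by exact_mod_cast hδ0.ne'
    have hI := Complex.I_sq
    rw [hμ, hD]
    push_cast
    field_simp
    ring_nf
    rw [hI]
    ring
  rw [← Complex.coe_smul, ← Complex.coe_smul, hvh]
  simp only [smul_add, smul_smul]
  rw [show ∀ a b c d : E, a + b + (c + d) = (a + c) + (b + d) from fun _ _ _ _ => by abel,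
    ← add_smul, ← add_smul]
  congr 2
  · ring
  · linear_combination (-(1 / 2 : ℝ) * (ε * κ) : ℂ) * hcomb

theorem HasBallLineSections.exists_profile (hK : HasBallLineSections K) (h0 : 0 ∈ K)
    (hconv : Convex ℝ K) (hl : ∀ x ∈ K, ‖x‖ ^ 2 ≤ 2 * (l x).re) {o : E} (ho : o ∈ interior K)
    (ho0 : o ≠ 0) :
    ∃ f : E → ℝ, ∀ v, l v = 1 → 0 < f v ∧ ∀ t : ℂ, t • v ∈ K ↔ f v * ‖t‖ ^ 2 ≤ t.re := by
  have key (v : E) : ∃ y : ℝ, l v = 1 → 0 < y ∧ ∀ t : ℂ, t • v ∈ K ↔ y * ‖t‖ ^ 2 ≤ t.re := by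
    by_cases hv : l v = 1
    · obtain ⟨r, hr0, hr⟩ := hK.exists_radius h0 hl hv
      obtain ⟨t, ht0, ht⟩ := hK.exists_smul_mem h0 hconv hl ho ho0 hv
      have hr0 := radius_pos_of_norm_sq_le ht0 hr hr0 ht
      refine ⟨(2 * r)⁻¹, fun _ => ⟨by positivity, fun t => ?_⟩⟩
      rw [hr, inv_mul_le_iff₀ (by positivity)]
    · exact ⟨0, fun h => absurd h hv⟩
  choose f hf using key
  exact ⟨f, hf⟩

theorem HasBallLineSections.hasBallAffineSublevels (hK : HasBallLineSections K)
    (hl : ∀ x ∈ K, ‖x‖ ^ 2 ≤ 2 * (l x).re) {f : E → ℝ}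
    (hf : ∀ v, l v = 1 → 0 < f v ∧ ∀ t : ℂ, t • v ∈ K ↔ f v * ‖t‖ ^ 2 ≤ t.re)
    {z b : E} (hz : l z = 1) (hb : l b = 0) (hb0 : b ≠ 0) :
    HasBallAffineSublevels fun s : ℂ => f (z + s • b) := by
  intro a c
  have hlz (s : ℂ) : l (z + s • b) = 1 := by rw [map_add, map_smul, hz, hb, smul_zero, add_zero]
  have hiff (s w : ℂ) (hw : w ≠ 0) : w⁻¹ • (z + s • b) ∈ K ↔ f (z + s • b) ≤ w.re := by
    rw [(hf _ (hlz s)).2, Complex.inv_re, norm_inv, ← Complex.sq_norm, inv_pow, ← div_eq_mul_inv]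
    exact div_le_div_iff_of_pos_right (by positivity)
  rcases eq_or_ne a 0 with rfl | ha
  · simp only [zero_mul, Complex.zero_re, zero_add]
    rcases le_or_gt c 0 with hc | hc
    · refine ⟨0, -1, ?_⟩
      rw [closedBall_eq_empty.2 (by norm_num)]
      exact Set.eq_empty_iff_forall_notMem.2 fun s hs =>
        ((hf _ (hlz s)).1.trans_le (hs.trans hc)).false
    · have hc0 : (c : ℂ) ≠ 0 := by exact_mod_cast hc.ne'
      obtain ⟨m, r, hS⟩ := hK ((c : ℂ)⁻¹ • z) ((c : ℂ)⁻¹ • b) (smul_ne_zero (inv_ne_zero hc0) hb0)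
      refine ⟨m, r, ?_⟩
      rw [← hS]
      ext s
      rw [Set.mem_ofPred_eq, Set.mem_ofPred_eq, smul_comm, ← smul_add, hiff _ _ hc0,
        Complex.ofReal_re]
  · set y : E := z - (c / a : ℂ) • b with hy
    have hly : l y = 1 := by rw [hy, map_sub, map_smul, hb, smul_zero, sub_zero, hz]
    have hy0 : y ≠ 0 := by
      rintro h
      rw [h, map_zero] at hly
      exact zero_ne_one hly
    obtain ⟨m, r, hS⟩ := hK (a⁻¹ • b) y hy0
    have hmem (t : ℂ) : a⁻¹ • b + t • y ∈ K ↔ ‖t - m‖ ≤ r := by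
      rw [← dist_eq_norm, ← mem_closedBall, ← hS, Set.mem_ofPred_eq]
    have hmr : r < ‖m‖ := by
      by_contra h
      have h1 := hl _ ((hmem 0).2 (by simpa using h))
      rw [zero_smul, add_zero, map_smul, hb, smul_zero, Complex.zero_re, mul_zero] at h1
      exact (pow_pos (norm_pos_iff.2 (smul_ne_zero (inv_ne_zero ha) hb0)) 2).not_ge h1
    have hset (s : ℂ) : f (z + s • b) ≤ (a * s).re + c ↔
        a * s + c ≠ 0 ∧ ‖(a * s + c)⁻¹ - m‖ ≤ r := by
      rcases eq_or_ne (a * s + c) 0 with hw | hw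
      · refine iff_of_false ?_ (by simp [hw])
        have : (a * s).re + c = 0 := by simpa using congrArg Complex.re hw
        rw [this]
        exact (hf _ (hlz s)).1.not_ge
      · have : (a * s).re + c = (a * s + c).re := by simp
        rw [this, ← hiff s _ hw, ← hmem, and_iff_right hw]
        refine iff_of_eq (congrArg (· ∈ K) ?_)
        rw [hy, smul_sub, smul_add, smul_smul, smul_smul, add_sub_left_comm, ← sub_smul]
        congr 2
        field_simp
        ring
    rcases lt_or_ge r 0 with hr | hr
    · refine ⟨0, -1, ?_⟩
      rw [closedBall_eq_empty.2 (by norm_num)]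
      exact Set.eq_empty_iff_forall_notMem.2 fun s hs =>
        hr.not_ge ((norm_nonneg _).trans ((hset s).1 hs).2)
    have hN : 0 < ‖m‖ ^ 2 - r ^ 2 := sub_pos.2 (pow_lt_pow_left₀ hmr hr two_ne_zero)
    obtain ⟨m', r', hS'⟩ := Complex.exists_closedBall_eq_quadratic_sublevel
      (mul_pos hN (pow_pos (norm_pos_iff.2 ha) 2))
      (2 * ((‖m‖ ^ 2 - r ^ 2) * c : ℝ) * a - 2 * m * a)
      ((‖m‖ ^ 2 - r ^ 2) * c ^ 2 - 2 * c * m.re + 1)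
    refine ⟨m', r', ?_⟩
    rw [← hS']
    ext s
    rw [Set.mem_ofPred_eq, Set.mem_ofPred_eq, hset]
    have hexp : (‖m‖ ^ 2 - r ^ 2) * ‖a‖ ^ 2 * ‖s‖ ^ 2 +
        ((2 * ((‖m‖ ^ 2 - r ^ 2) * c : ℝ) * a - 2 * m * a) * s).re +
        ((‖m‖ ^ 2 - r ^ 2) * c ^ 2 - 2 * c * m.re + 1)
        = ‖1 - m * (a * s + c)‖ ^ 2 - r ^ 2 * ‖a * s + c‖ ^ 2 := by
      simp only [Complex.sq_norm, Complex.normSq_apply, Complex.sub_re, Complex.sub_im,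
        Complex.add_re, Complex.add_im, Complex.mul_re, Complex.mul_im, Complex.ofReal_re,
        Complex.ofReal_im, Complex.re_ofNat, Complex.im_ofNat, Complex.one_re, Complex.one_im]
      ring
    rw [hexp, sub_nonpos, ← mul_pow, sq_le_sq₀ (norm_nonneg _) (by positivity)]
    rcases eq_or_ne (a * s + c) 0 with hw | hw
    · simp [hw]
    · rw [and_iff_right hw, ← mul_le_mul_iff_left₀ (norm_pos_iff.2 hw), ← norm_mul, sub_mul,
        inv_mul_cancel₀ hw]

theorem HasBallLineSections.exists_quadratic_sublevel [FiniteDimensional ℂ E]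
    (hK : HasBallLineSections K) (hcomp : IsCompact K) (h0 : 0 ∈ K)
    (hconv : Convex ℝ K) (hl : ∀ x ∈ K, ‖x‖ ^ 2 ≤ 2 * (l x).re) {o : E} (ho : o ∈ interior K)
    (ho0 : o ≠ 0) :
    ∃ (P : E → ℝ) (x₀ : E), (∀ (t : ℂ) x, P (t • x) = ‖t‖ ^ 2 * P x) ∧
      (∀ x y, ∃ a : ℂ, ∀ t : ℂ, P (y + t • x) = ‖t‖ ^ 2 * P x + (a * t).re + P y) ∧
      (∀ x, x ≠ 0 → 0 < P x) ∧ ∀ x, x ∈ K ↔ P (x - x₀) ≤ 1 := by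
  obtain ⟨f, hf⟩ := hK.exists_profile h0 hconv hl ho ho0
  have hline {z b : E} (hz : l z = 1) (hb : l b = 0) (hb0 : b ≠ 0) :=
    (hK.hasBallAffineSublevels hl hf hz hb hb0).exists_eq_quadratic
  obtain ⟨v, hv, hmin⟩ : ∃ v, l v = 1 ∧ ∀ y, l y = 1 → f v ≤ f y := by
    have hlc : Continuous l := l.continuous_of_finiteDimensional
    obtain ⟨p, hpK, hp⟩ := hcomp.exists_isMaxOn ⟨0, h0⟩
      (Complex.continuous_re.comp hlc).continuousOn
    have hp (x) (hx : x ∈ K) : (l x).re ≤ (l p).re := hp hx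
    have hp0 : 0 < (l p).re := by
      have h1 := hl o (interior_subset ho)
      have h2 := pow_pos (norm_pos_iff.2 ho0) 2
      linarith [hp o (interior_subset ho)]
    have hlp : l p ≠ 0 := by
      rintro h
      rw [h, Complex.zero_re] at hp0
      exact hp0.false
    have hlv : l ((l p)⁻¹ • p) = 1 := by rw [map_smul, smul_eq_mul, inv_mul_cancel₀ hlp]
    refine ⟨(l p)⁻¹ • p, hlv, fun y hy => ?_⟩
    have h1 := ((hf _ hlv).2 (l p)).1 (by rwa [smul_inv_smul₀ hlp])
    have hfy := (hf y hy).1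
    have h2 := hp _ (((hf y hy).2 ((f y)⁻¹ : ℝ)).2 (by
      rw [Complex.norm_real, Real.norm_of_nonneg (by positivity), Complex.ofReal_re]
      apply le_of_eq
      field_simp))
    rw [map_smul, hy, smul_eq_mul, mul_one, Complex.ofReal_re, inv_le_iff_one_le_mul₀ hfy] at h2
    have h3 : (l p).re ^ 2 ≤ ‖l p‖ ^ 2 := by
      rw [Complex.sq_norm, Complex.normSq_apply]
      nlinarith [mul_self_nonneg (l p).im]
    have h4 : f ((l p)⁻¹ • p) * (l p).re ≤ 1 := by
      refine le_of_mul_le_mul_right ?_ hp0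
      nlinarith [mul_le_mul_of_nonneg_left h3 (hf _ hlv).1.le]
    exact le_of_mul_le_mul_right (by linarith) hp0
  set c := f v with hc
  have hc0 : 0 < c := (hf v hv).1
  set q : E → ℝ := fun h => f (v + h) - c with hq
  have hq0 : q 0 = 0 := by rw [hq]; simp [hc]
  have hqline {h : E} (hh : l h = 0) (hh0 : h ≠ 0) :
      0 < q h ∧ ∀ s : ℂ, q (s • h) = ‖s‖ ^ 2 * q h := by
    obtain ⟨Q, a, c', hQ, hfs⟩ := hline hv hh hh0
    have hc' : c' = c := by simpa using (hfs 0).symm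
    have ha : a = 0 := by
      have h1 := hmin (v + (-((2 * Q)⁻¹ : ℝ) * conj a : ℂ) • h)
        (by rw [map_add, map_smul, hh, hv, smul_zero, add_zero])
      rw [hfs, hc', show a * (-((2 * Q)⁻¹ : ℝ) * conj a) = (-((2 * Q)⁻¹ : ℝ) : ℂ) * (a * conj a) by
        ring, Complex.mul_conj', ← Complex.ofReal_neg, Complex.re_ofReal_mul, norm_mul,
        Complex.norm_real, norm_neg, Real.norm_of_nonneg (by positivity), RCLike.norm_conj,
        ← Complex.ofReal_pow, Complex.ofReal_re] at h1
      have h2 : Q * ((2 * Q)⁻¹ * ‖a‖) ^ 2 + -(2 * Q)⁻¹ * ‖a‖ ^ 2 = -((4 * Q)⁻¹ * ‖a‖ ^ 2) := by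
        field_simp
        ring
      by_contra ha
      have h3 : 0 < (4 * Q)⁻¹ * ‖a‖ ^ 2 := by positivity
      linarith
    have hqs (s : ℂ) : q (s • h) = Q * ‖s‖ ^ 2 := by
      simp only [hq, hfs, ha, hc', zero_mul, Complex.zero_re]
      ring
    have hq1 : q h = Q := by simpa using hqs 1
    exact ⟨hq1 ▸ hQ, fun s => by rw [hqs, hq1, mul_comm]⟩
  have hqsmul {h : E} (hh : l h = 0) (s : ℂ) : q (s • h) = ‖s‖ ^ 2 * q h := by
    rcases eq_or_ne h 0 with rfl | hh0
    · rw [smul_zero, hq0, mul_zero]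
    · exact (hqline hh hh0).2 s
  have hqquad {x y : E} (hx : l x = 0) (hy : l y = 0) :
      ∃ a : ℂ, ∀ t : ℂ, q (y + t • x) = ‖t‖ ^ 2 * q x + (a * t).re + q y := by
    rcases eq_or_ne x 0 with rfl | hx0
    · exact ⟨0, fun t => by simp [hq0]⟩
    rcases eq_or_ne y 0 with rfl | hy0
    · exact ⟨0, fun t => by simp [hq0, hqsmul hx]⟩
    have hqshift {x y : E} (hx : l x = 0) (hx0 : x ≠ 0) (hy : l y = 0) : ∃ (Q : ℝ) (a : ℂ),
        ∀ t : ℂ, q (y + t • x) = ‖t‖ ^ 2 * Q + (a * t).re + q y := by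
      obtain ⟨Q, a, c', -, hfs⟩ := hline (z := v + y) (by rw [map_add, hv, hy, add_zero]) hx hx0
      have hc' : c' = f (v + y) := by simpa using (hfs 0).symm
      refine ⟨Q, a, fun t => ?_⟩
      simp only [hq, ← add_assoc, hfs, hc']
      ring
    obtain ⟨Q, a, hQ⟩ := hqshift hx hx0 hy
    obtain ⟨Q', a', hQ'⟩ := hqshift hy hy0 hx
    have hswap (t : ℝ) (ht : t ≠ 0) : q (y + (t : ℂ) • x) = t ^ 2 * q (x + (t⁻¹ : ℝ) • y) := by
      have htc : (t : ℂ) ≠ 0 := by exact_mod_cast ht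
      rw [← Complex.coe_smul, show y + (t : ℂ) • x = (t : ℂ) • (x + ((t⁻¹ : ℝ) : ℂ) • y) by
        rw [smul_add, Complex.ofReal_inv, smul_inv_smul₀ htc, add_comm],
        hqsmul (by rw [map_add, map_smul, hx, hy, smul_zero, add_zero]), Complex.norm_real,
        Real.norm_eq_abs, sq_abs]
    have hcompare (t : ℝ) (ht : t ≠ 0) :
        t ^ 2 * Q + t * a.re + q y = Q' + t * a'.re + t ^ 2 * q x := by
      have h1 := hswap t ht
      rw [← Complex.coe_smul, hQ, hQ'] at h1
      simp only [Complex.norm_real, Real.norm_eq_abs, sq_abs, Complex.re_mul_ofReal] at h1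
      field_simp at h1
      linarith
    have h1 := hcompare 1 (by norm_num)
    have h2 := hcompare (-1) (by norm_num)
    have h3 := hcompare 2 (by norm_num)
    have h4 := hcompare (-2) (by norm_num)
    have hQq : Q = q x := by linarith
    exact ⟨a, fun t => by rw [hQ, hQq]⟩
  have hproj (x : E) : l (x - l x • v) = 0 := by
    rw [map_sub, map_smul, hv, smul_eq_mul, mul_one, sub_self]
  have hmemK (x : E) : x ∈ K ↔ c * ‖l x‖ ^ 2 + q (x - l x • v) ≤ (l x).re := by
    rcases eq_or_ne (l x) 0 with hx | hx
    · rw [hx, norm_zero, zero_smul, sub_zero, Complex.zero_re, zero_pow two_ne_zero, mul_zero,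
        zero_add]
      rcases eq_or_ne x 0 with rfl | hx0
      · exact iff_of_true h0 hq0.le
      · refine iff_of_false (fun hxK => ?_) (hqline hx hx0).1.not_ge
        have := hl x hxK
        rw [hx, Complex.zero_re, mul_zero] at this
        exact (pow_pos (norm_pos_iff.2 hx0) 2).not_ge this
    · have hlx : l ((l x)⁻¹ • x) = 1 := by rw [map_smul, smul_eq_mul, inv_mul_cancel₀ hx]
      have h1 := (hf _ hlx).2 (l x)
      rw [smul_inv_smul₀ hx] at h1
      have h2 : c * ‖l x‖ ^ 2 + q (x - l x • v) = f ((l x)⁻¹ • x) * ‖l x‖ ^ 2 := by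
        rw [show x - l x • v = l x • ((l x)⁻¹ • x - v) by rw [smul_sub, smul_inv_smul₀ hx],
          hqsmul (by rw [map_sub, hlx, hv, sub_self])]
        simp only [hq, add_sub_cancel]
        ring
      rw [h1, h2]
  refine ⟨fun x => 4 * c * (c * ‖l x‖ ^ 2 + q (x - l x • v)), ((2 * c)⁻¹ : ℝ) • v,
    fun t x => ?_, fun x y => ?_, fun x hx => ?_, fun x => ?_⟩
  · have : t • x - l (t • x) • v = t • (x - l x • v) := by
      rw [map_smul, smul_eq_mul, smul_sub, smul_smul]
    beta_reduce
    rw [this, hqsmul (hproj x), map_smul, smul_eq_mul, norm_mul]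
    ring
  · obtain ⟨a, ha⟩ := hqquad (hproj x) (hproj y)
    refine ⟨(4 * c : ℝ) * a + (8 * c ^ 2 : ℝ) * (conj (l y) * l x), fun t => ?_⟩
    have h1 : y + t • x - l (y + t • x) • v = y - l y • v + t • (x - l x • v) := by
      rw [map_add, map_smul, smul_eq_mul, smul_sub, smul_smul, add_smul]
      abel
    have h2 : ‖l (y + t • x)‖ ^ 2
        = ‖t‖ ^ 2 * ‖l x‖ ^ 2 + 2 * (conj (l y) * l x * t).re + ‖l y‖ ^ 2 := by
      rw [map_add, map_smul, smul_eq_mul]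
      simp only [Complex.sq_norm, Complex.normSq_apply, Complex.add_re, Complex.add_im,
        Complex.mul_re, Complex.mul_im, Complex.conj_re, Complex.conj_im]
      ring
    simp only [h1, h2, ha]
    rw [add_mul, mul_assoc _ a, mul_assoc _ (conj (l y) * l x), Complex.add_re,
      Complex.re_ofReal_mul, Complex.re_ofReal_mul]
    ring
  · have h1 : 0 ≤ q (x - l x • v) := by
      rcases eq_or_ne (x - l x • v) 0 with h | h
      · rw [h, hq0]
      · exact (hqline (hproj x) h).1.le
    rcases eq_or_ne (l x) 0 with h | h
    · have h2 := (hqline h hx).1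
      simp only [h, norm_zero, zero_smul, sub_zero]
      positivity
    · positivity
  · have hx₀ : l (((2 * c)⁻¹ : ℝ) • v) = ((2 * c)⁻¹ : ℝ) := by
      rw [← Complex.coe_smul, map_smul, hv, smul_eq_mul, mul_one]
    have h1 : x - ((2 * c)⁻¹ : ℝ) • v - l (x - ((2 * c)⁻¹ : ℝ) • v) • v = x - l x • v := by
      rw [map_sub, hx₀, sub_smul, Complex.coe_smul]
      abel
    have h2 : ‖l (x - ((2 * c)⁻¹ : ℝ) • v)‖ ^ 2
        = ‖l x‖ ^ 2 - (l x).re / c + (4 * c ^ 2)⁻¹ := by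
      rw [map_sub, hx₀]
      simp only [Complex.sq_norm, Complex.normSq_apply, Complex.sub_re, Complex.sub_im,
        Complex.ofReal_re, Complex.ofReal_im]
      field_simp
      ring
    have h3 : 4 * c * (c * ‖l (x - ((2 * c)⁻¹ : ℝ) • v)‖ ^ 2 + q (x - l x • v)) - 1
        = 4 * c * (c * ‖l x‖ ^ 2 + q (x - l x • v) - (l x).re) := by
      rw [h2]
      field_simp
      ring
    beta_reduce
    rw [hmemK, h1, ← sub_nonpos, ← sub_nonpos (b := (1 : ℝ)), h3]
    exact ⟨fun h => mul_nonpos_of_nonneg_of_nonpos (by positivity) h,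
      fun h => nonpos_of_mul_nonpos_right h (by positivity)⟩

end LineSections

/-- A positive real function which is a rotationally symmetric quadratic on every complex line is
the squared norm of a Hermitian inner product. -/
theorem exists_linearEquiv_euclideanSpace_of_quadratic {E : Type*} [AddCommGroup E] [Module ℂ E]
    [FiniteDimensional ℂ E] {n : ℕ} (hn : Module.finrank ℂ E = n) {q : E → ℝ}
    (hsmul : ∀ (t : ℂ) x, q (t • x) = ‖t‖ ^ 2 * q x)
    (hquad : ∀ x y, ∃ a : ℂ, ∀ t : ℂ, q (y + t • x) = ‖t‖ ^ 2 * q x + (a * t).re + q y)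
    (hpos : ∀ x, x ≠ 0 → 0 < q x) :
    ∃ T : EuclideanSpace ℂ (Fin n) ≃ₗ[ℂ] E, ∀ x, q (T x) = ‖x‖ ^ 2 := by
  choose A hA using hquad
  have hre (x y) : (A x y).re = q (y + x) - q x - q y := by
    have := hA x y 1
    rw [one_smul, norm_one, mul_one] at this
    linarith
  have hneg (x) : q (-x) = q x := by simpa using hsmul (-1) x
  have hpar (x y) : q (x + y) + q (x - y) = 2 * q x + 2 * q y := by
    have h1 := hA y x 1
    have h2 := hA y x (-1)
    simp only [one_smul, neg_smul, norm_neg, norm_one, mul_one, mul_neg, Complex.neg_re,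
      ← sub_eq_add_neg] at h1 h2
    linarith
  have hcub (x y z) : q (x + y + z) + q x + q y + q z = q (x + y) + q (y + z) + q (x + z) := by
    have h1 := hpar (x + y) z
    have h2 := hpar (x - z) y
    have h3 := hpar x (y + z)
    have h4 := hpar x z
    rw [show x - z + y = x + y - z by abel, show x - z - y = x - (y + z) by abel] at h2
    rw [← add_assoc] at h3
    linarith
  have ext_re {a b : ℂ} (h : ∀ t : ℂ, (a * t).re = (b * t).re) : a = b := by
    refine Complex.ext (by simpa using h 1) ?_
    have := h Complex.I
    simpa using this
  have hAsmul (s : ℂ) (x y) : A (s • x) y = s * A x y := ext_re fun t => by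
    have h1 := hA (s • x) y t
    have h2 := hA x y (t * s)
    rw [smul_smul, hsmul, h2, norm_mul, mul_pow] at h1
    rw [show s * A x y * t = A x y * (t * s) by ring]
    linarith
  have hreadd (x x' y) : (A (x + x') y).re = (A x y).re + (A x' y).re := by
    have := hcub y x x'
    simp only [hre, ← add_assoc]
    linarith
  have hAadd (x x' y) : A (x + x') y = A x y + A x' y := ext_re fun t => by
    have := hreadd (t • x) (t • x') y
    rw [← smul_add, hAsmul, hAsmul, hAsmul] at this
    rw [add_mul, Complex.add_re, mul_comm, this, mul_comm t, mul_comm t]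
  have hresymm (x y) : (A x y).re = (A y x).re := by
    rw [hre, hre, add_comm]
    ring
  have hconj (x y) : conj (A x y) = A y x := by
    refine Complex.ext (by simpa using hresymm x y) ?_
    have h1 : (A (Complex.I • x) y).re = -(A (Complex.I • y) x).re := by
      have h2 : (A (-(Complex.I • y)) x).re = -(A (Complex.I • y) x).re := by
        rw [← neg_one_smul ℂ, hAsmul]
        simp
      have h3 : q (y + Complex.I • x) = q (x + -(Complex.I • y)) := by
        rw [show y + Complex.I • x = Complex.I • (x + -(Complex.I • y)) by
          rw [smul_add, smul_neg, smul_smul, Complex.I_mul_I, neg_one_smul, neg_neg, add_comm],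
          hsmul]
        simp
      rw [← h2, hre, hre, h3, hneg, hsmul, hsmul]
      simp
      ring
    rw [hAsmul, hAsmul] at h1
    simp at h1 ⊢
    linarith
  have hself (x) : A x x = (2 * q x : ℝ) := by
    refine Complex.ext ?_ ?_
    · have := hsmul 2 x
      rw [two_smul] at this
      rw [hre, this, Complex.ofReal_re, Complex.norm_ofNat]
      ring
    · rw [Complex.ofReal_im]
      exact Complex.conj_eq_iff_im.1 (hconj x x)
  have hnonneg (x) : 0 ≤ q x := by
    rcases eq_or_ne x 0 with rfl | hx
    · have := hsmul 0 (0 : E)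
      rw [zero_smul, norm_zero] at this
      linarith
    · exact (hpos x hx).le
  let core : InnerProductSpace.Core ℂ E :=
    { inner x y := A y x / 2
      conj_inner_symm x y := by rw [map_div₀, hconj, map_ofNat]
      re_inner_nonneg x := by
        rw [hself, ← Complex.ofReal_ofNat, ← Complex.ofReal_div]
        simpa using hnonneg x
      add_left x y z := by
        rw [← hconj, hAadd, map_add, hconj, hconj, add_div]
      smul_left x y r := by
        rw [← hconj, hAsmul, map_mul, hconj, mul_div_assoc]
      definite x hx := by
        by_contra h
        rw [hself, ← Complex.ofReal_ofNat, ← Complex.ofReal_div, Complex.ofReal_eq_zero] at hx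
        linarith [hpos x h] }
  let : NormedAddCommGroup E := core.toNormedAddCommGroup
  let : InnerProductSpace ℂ E := InnerProductSpace.ofCore core.toCore
  have hnorm (x : E) : q x = ‖x‖ ^ 2 := by
    have h : ‖x‖ ^ 2 = (A x x / 2).re := norm_sq_eq_re_inner (𝕜 := ℂ) x
    rw [h, hself, ← Complex.ofReal_ofNat, ← Complex.ofReal_div, Complex.ofReal_re]
    ring
  subst hn
  let e := (stdOrthonormalBasis ℂ E).repr.symm
  exact ⟨e.toLinearEquiv, fun x => by rw [hnorm]; exact congrArg (· ^ 2) (e.norm_map x)⟩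

theorem isComplexLine_inter_iff {V : Type*} [AddCommGroup V] [Module ℂ V] (K : Set V) {a b : V}
    (hb : b ≠ 0) :
    ({x | ∃ t : ℂ, x = a + t • b} ∩ K = ∅ ∨ (∃ p, {x | ∃ t : ℂ, x = a + t • b} ∩ K = {p}) ∨
      IsComplexDisk ({x | ∃ t : ℂ, x = a + t • b} ∩ K)) ↔
    ∃ (m : ℂ) (r : ℝ), {t : ℂ | a + t • b ∈ K} = closedBall m r := by
  set φ : ℂ → V := fun t => a + t • b with hφ
  have hinj : Function.Injective φ := fun s t h => smul_left_injective ℂ hb (add_left_cancel h)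
  have hline : {x | ∃ t : ℂ, x = a + t • b} ∩ K = φ '' (φ ⁻¹' K) := by
    rw [Set.image_preimage_eq_range_inter]
    congr 1
    ext x
    exact exists_congr fun _ => eq_comm
  have hpre : {t : ℂ | a + t • b ∈ K} = φ ⁻¹' K := rfl
  rw [hline, hpre]
  generalize φ ⁻¹' K = S
  constructor
  · rintro (h | ⟨p, hp⟩ | ⟨a', b', r, hr, hb', h⟩)
    · exact ⟨0, -1, by rw [Set.image_eq_empty.1 h, closedBall_eq_empty.2 (by norm_num)]⟩
    · obtain ⟨t, -, rfl⟩ : p ∈ φ '' S := hp ▸ Set.mem_singleton p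
      rw [← Set.image_singleton] at hp
      exact ⟨t, 0, by rw [hinj.image_injective hp, closedBall_zero]⟩
    · have hmem (t : ℂ) (ht : ‖t‖ ≤ r) : ∃ s, φ s = a' + t • b' := by
        have : a' + t • b' ∈ φ '' S := h ▸ ⟨t, by simpa using ht, rfl⟩
        exact this.imp fun s hs => hs.2
      obtain ⟨s₀, hs₀⟩ := hmem 0 (by simpa using hr.le)
      obtain ⟨s₁, hs₁⟩ := hmem r (by simp [abs_of_pos hr])
      rw [zero_smul, add_zero] at hs₀
      have hrc : (r : ℂ) ≠ 0 := by exact_mod_cast hr.ne'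
      have hbb : b' = ((r : ℂ)⁻¹ * (s₁ - s₀)) • b := by
        rw [mul_smul, eq_inv_smul_iff₀ hrc, sub_smul, ← add_right_inj a', ← hs₁, ← hs₀]
        simp only [hφ]
        abel
      generalize (r : ℂ)⁻¹ * (s₁ - s₀) = β at hbb
      have hβ : β ≠ 0 := by
        rintro rfl
        exact hb' (by rw [hbb, zero_smul])
      refine ⟨s₀, r * ‖β‖, hinj.image_injective ?_⟩
      rw [h]
      have hφβ (t : ℂ) : a' + t • b' = φ (s₀ + t * β) := by
        rw [hbb, ← hs₀, smul_smul]
        simp only [hφ, add_smul]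
        abel
      ext x
      constructor
      · rintro ⟨t, ht, rfl⟩
        refine ⟨s₀ + t * β, ?_, (hφβ t).symm⟩
        rw [mem_closedBall, dist_self_add_left, norm_mul]
        exact mul_le_mul_of_nonneg_right (by simpa using ht) (norm_nonneg _)
      · rintro ⟨s, hs, rfl⟩
        refine ⟨(s - s₀) / β, ?_, ?_⟩
        · rw [mem_closedBall, dist_zero_right, norm_div, div_le_iff₀ (norm_pos_iff.2 hβ),
            ← dist_eq_norm]
          exact hs
        · beta_reduce
          rw [hφβ, div_mul_cancel₀ _ hβ, add_sub_cancel]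
  · rintro ⟨m, r, rfl⟩
    rcases lt_trichotomy r 0 with hr | rfl | hr
    · exact Or.inl (by rw [closedBall_eq_empty.2 hr, Set.image_empty])
    · exact Or.inr (Or.inl ⟨φ m, by rw [closedBall_zero, Set.image_singleton]⟩)
    · refine Or.inr (Or.inr ⟨a + m • b, b, r, hr, hb, ?_⟩)
      rw [show closedBall m r = (m + ·) '' closedBall 0 r by simp, Set.image_image]
      exact Set.image_congr fun t _ => by simp only [hφ, add_smul, add_assoc]

theorem forall_isComplexLine_iff_hasBallLineSections {E : Type*} [NormedAddCommGroup E]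
    [NormedSpace ℂ E] (K : Set E) :
    (∀ L : Set E, IsComplexLine L →
      (L ∩ K = ∅ ∨ (∃ p, L ∩ K = {p}) ∨ IsComplexDisk (L ∩ K))) ↔ HasBallLineSections K := by
  constructor
  · exact fun h a b hb => (isComplexLine_inter_iff K hb).1 (h _ ⟨a, b, hb, rfl⟩)
  · rintro h _ ⟨a, b, hb, rfl⟩
    exact (isComplexLine_inter_iff K hb).2 (h a b hb)

theorem IsComplexEllipsoid.hasBallLineSections {n : ℕ} {K : Set (EuclideanSpace ℂ (Fin n))}
    (hK : IsComplexEllipsoid n K) : HasBallLineSections K := by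
  obtain ⟨T, v, rfl⟩ := hK
  intro a b hb
  set u := T.symm (a - v) with hu
  set y := T.symm b with hy
  have hy0 : y ≠ 0 := by simpa [hy] using hb
  obtain ⟨m, r, h⟩ := Complex.exists_closedBall_eq_quadratic_sublevel
    (pow_pos (norm_pos_iff.2 hy0) 2) (2 * inner ℂ u y) (‖u‖ ^ 2 - 1)
  refine ⟨m, r, ?_⟩
  rw [← h]
  ext t
  have hmem : a + t • b ∈ (fun x => T x + v) '' closedBall 0 1 ↔ ‖u + t • y‖ ≤ 1 := by
    have hT : T (u + t • y) + v = a + t • b := by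
      rw [map_add, map_smul, hu, hy, T.apply_symm_apply, T.apply_symm_apply]
      abel
    rw [← hT, ← mem_closedBall_zero_iff]
    exact Function.Injective.mem_set_image fun x x' hx => T.injective (add_right_cancel hx)
  have hexp : ‖u + t • y‖ ^ 2 = ‖u‖ ^ 2 + 2 * (t * inner ℂ u y).re + (‖t‖ * ‖y‖) ^ 2 := by
    rw [@norm_add_sq ℂ, inner_smul_right, norm_smul]
    rfl
  rw [Set.mem_ofPred_eq, Set.mem_ofPred_eq, hmem, ← sq_le_one_iff₀ (norm_nonneg _), hexp,
    mul_assoc, ← Complex.ofReal_ofNat, Complex.re_ofReal_mul, mul_comm t]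
  constructor <;> intro h <;> linarith

theorem HasBallLineSections.isComplexEllipsoid {n : ℕ} (hn : 1 ≤ n)
    {K : Set (EuclideanSpace ℂ (Fin n))} (hK : HasBallLineSections K) (hKc : IsCompact K)
    (hKconv : Convex ℝ K) (hKint : (interior K).Nonempty) : IsComplexEllipsoid n K := by
  have : Nonempty (Fin n) := ⟨⟨0, hn⟩⟩
  obtain ⟨p, hpK, hp⟩ := hKc.exists_isMaxOn (hKint.mono interior_subset) continuous_norm.continuousOn
  obtain ⟨o, ho, hop⟩ : ∃ o ∈ interior K, o ≠ p := by
    obtain ⟨x, hx⟩ := hKint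
    exact (infinite_of_mem_nhds x (isOpen_interior.mem_nhds hx)).nontrivial.exists_ne p
  have hint : o - p ∈ interior ((fun x => x + p) ⁻¹' K) := by
    rw [← Homeomorph.coe_addRight, ← Homeomorph.preimage_interior]
    simpa using ho
  have hl (x) (hx : x ∈ (fun x => x + p) ⁻¹' K) :
      ‖x‖ ^ 2 ≤ 2 * ((-(innerSL ℂ p).toLinearMap) x).re := by
    have h1 : ‖x + p‖ ≤ ‖p‖ := hp hx
    have h2 := pow_le_pow_left₀ (norm_nonneg _) h1 2
    rw [add_comm, @norm_add_sq ℂ] at h2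
    have h3 : ((-(innerSL ℂ p).toLinearMap) x).re = -RCLike.re (inner ℂ p x) := rfl
    linarith
  have hsec : HasBallLineSections ((fun x => x + p) ⁻¹' K) := fun a b hb => by
    obtain ⟨m, r, h⟩ := hK (a + p) b hb
    refine ⟨m, r, ?_⟩
    rw [← h]
    ext t
    rw [Set.mem_ofPred_eq, Set.mem_ofPred_eq, Set.mem_preimage, add_right_comm]
  obtain ⟨P, x₀, hsmul, hquad, hpos, hPK⟩ := hsec.exists_quadratic_sublevel
    ((Homeomorph.addRight p).isCompact_preimage.2 hKc) (by simpa using hpK)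
    (hKconv.translate_preimage_left p) hl hint (sub_ne_zero.2 hop)
  obtain ⟨T, hT⟩ := exists_linearEquiv_euclideanSpace_of_quadratic (finrank_euclideanSpace_fin)
    hsmul hquad hpos
  refine ⟨T, x₀ + p, ?_⟩
  ext x
  have h1 : x ∈ K ↔ P (x - p - x₀) ≤ 1 := by rw [← hPK, Set.mem_preimage, sub_add_cancel]
  rw [h1]
  constructor
  · intro h
    refine ⟨T.symm (x - p - x₀), ?_, ?_⟩
    · rwa [mem_closedBall_zero_iff, ← sq_le_one_iff₀ (norm_nonneg _), ← hT, T.apply_symm_apply]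
    · beta_reduce
      rw [T.apply_symm_apply]
      abel
  · rintro ⟨y, hy, rfl⟩
    rw [show T y + (x₀ + p) - p - x₀ = T y by abel, hT, sq_le_one_iff₀ (norm_nonneg _)]
    exact mem_closedBall_zero_iff.1 hy

/-- A convex body `K ⊂ ℂⁿ` is a complex ellipsoid iff every complex line
section of `K` is empty, a single point, or a disk. -/
theorem ellipsoid_iff_line_sections_disks (n : ℕ) (hn : 1 ≤ n)
    (K : Set (EuclideanSpace ℂ (Fin n)))
    (hKc : IsCompact K) (hKconv : Convex ℝ K) (hKint : (interior K).Nonempty) :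
    IsComplexEllipsoid n K ↔
      ∀ L : Set (EuclideanSpace ℂ (Fin n)), IsComplexLine L →
        (L ∩ K = ∅ ∨ (∃ p, L ∩ K = {p}) ∨ IsComplexDisk (L ∩ K)) := by
  rw [forall_isComplexLine_iff_hasBallLineSections]
  exact ⟨fun h => h.hasBallLineSections, fun h => h.isComplexEllipsoid hn hKc hKconv hKint⟩
end
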